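/- Let 1/n ≪ 1/C' ≪ 1/C ≪ α, 1/k, 1/s, 1/t, where n, k, s, t, C ∈ ℕ, and let δ ∈ [0,1]. If H = {H_1, …, H_{tn}} is a k-graph system on sn vertices with δ_d(H) ≥ (δ + α)·binom(sn−d, k−d), then there exists a probability distribution over pairs of partitions U = {U_1, …, U_m} of the vertex set V(H) and W = {W_1, …, W_m} of the color set [tn] satisfying: (1) |U_i| = sC and |W_i| = tC for each 2 ≤ i ≤ m, while |U_1| equals sC(C−1) plus the remainder when sn is divided by sC(C−1), and |W_1| equals tC(C−1) plus the remainder when tn is divided by tC(C−1); (2) for every i ∈ [m], the sub-system H_i = {H_j[U_i] : j ∈ W_i} satisfies δ_d(H_i) ≥ (δ + α/2)·binom(|U_i|−d, k−d); (3) for all distinct vertices y_1, …, y_r ∈ V(H), distinct colors c_1, …, c_ℓ ∈ [tn], and functions f: [r] → [m], g: [ℓ] → [m], the probability that y_i ∈ U_{f(i)} for all i ∈ [r] and c_j ∈ W_{g(j)} for all j ∈ [ℓ] is at most (C'/n)^{r+ℓ}. -/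

import Mathlib

open Finset in
open Classical in
theorem lopsided_local_lemma {ι Ω : Type*} [Fintype Ω] (E : ι → Ω → Prop) (w : ι → ℝ)
    (nb : ι → ι → Prop) [Fintype ι] (hw : ∀ i, 0 ≤ w i)
    (hind : ∀ i (S : Finset ι), (∀ j ∈ S, ¬ nb i j) →
      (#{ω | E i ω ∧ ∀ j ∈ S, ¬ E j ω} : ℝ) ≤ w i * #{ω | ∀ j ∈ S, ¬ E j ω})
    (hsum : ∀ i, ∑ j with nb i j, w j ≤ 1 / 4) (S : Finset ι) (i : ι) :
    (#{ω | E i ω ∧ ∀ j ∈ S, ¬ E j ω} : ℝ) ≤ 2 * w i * #{ω | ∀ j ∈ S, ¬ E j ω} := by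
  induction S using Finset.strongInduction generalizing i with
  | H S ih =>
    set S₂ := S.filter (fun j => ¬ nb i j) with hS₂
    by_cases hS : S₂ = S
    · have h := hind i S (fun j hj => by rw [← hS] at hj; exact (mem_filter.1 hj).2)
      have : 0 ≤ w i * (#{ω | ∀ j ∈ S, ¬ E j ω} : ℝ) := mul_nonneg (hw i) (by positivity)
      linarith
    · have hss : S₂ ⊂ S := (filter_subset _ _).ssubset_of_ne hS
      have h1 : (#{ω | E i ω ∧ ∀ j ∈ S, ¬ E j ω} : ℝ) ≤ w i * #{ω | ∀ j ∈ S₂, ¬ E j ω} := by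
        refine le_trans ?_ (hind i S₂ (fun j hj => (mem_filter.1 hj).2))
        have hsub : ({ω | E i ω ∧ ∀ j ∈ S, ¬ E j ω} : Finset Ω) ⊆
            ({ω | E i ω ∧ ∀ j ∈ S₂, ¬ E j ω} : Finset Ω) :=
          monotone_filter_right _ fun ω _ h => ⟨h.1, fun j hj => h.2 j (hss.1 hj)⟩
        exact_mod_cast card_le_card hsub
      have h2 : (#{ω | ∀ j ∈ S₂, ¬ E j ω} : ℝ) ≤ #{ω | ∀ j ∈ S, ¬ E j ω} +
          ∑ j with nb i j, (#{ω | E j ω ∧ ∀ j ∈ S₂, ¬ E j ω} : ℝ) := by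
        have : ({ω | ∀ j ∈ S₂, ¬ E j ω} : Finset Ω) ⊆
            ({ω | ∀ j ∈ S, ¬ E j ω} : Finset Ω) ∪
            (univ.filter (nb i)).biUnion (fun j => {ω | E j ω ∧ ∀ j ∈ S₂, ¬ E j ω}) := by
          intro ω hω
          simp only [mem_filter, mem_univ, true_and, mem_union, mem_biUnion] at hω ⊢
          by_contra! hcon
          obtain ⟨⟨j, hj, hEj⟩, h⟩ := hcon
          by_cases hn : nb i j
          · obtain ⟨j', hj', hE⟩ := h j hn hEj
            exact hω j' hj' hE
          · exact hω j (mem_filter.2 ⟨hj, hn⟩) hEj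
        have h3 := (card_le_card this).trans (card_union_le _ _)
        have h4 := h3.trans (Nat.add_le_add_left card_biUnion_le _)
        exact_mod_cast h4
      have h5 : ∑ j with nb i j, (#{ω | E j ω ∧ ∀ j ∈ S₂, ¬ E j ω} : ℝ) ≤
          1 / 2 * #{ω | ∀ j ∈ S₂, ¬ E j ω} := by
        calc _ ≤ ∑ j with nb i j, 2 * w j * (#{ω | ∀ j ∈ S₂, ¬ E j ω} : ℝ) :=
              sum_le_sum fun j _ => ih S₂ hss j
          _ = 2 * (∑ j with nb i j, w j) * (#{ω | ∀ j ∈ S₂, ¬ E j ω} : ℝ) := by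
              rw [← sum_mul, ← mul_sum]
          _ ≤ _ := by gcongr; linarith [hsum i]
      have h6 : (#{ω | ∀ j ∈ S₂, ¬ E j ω} : ℝ) ≤ 2 * #{ω | ∀ j ∈ S, ¬ E j ω} := by linarith
      nlinarith [mul_le_mul_of_nonneg_left h6 (hw i)]

open Finset in
open Classical in
theorem avoid_lower_bound {ι Ω : Type*} [Fintype Ω] (E : ι → Ω → Prop) (w : ι → ℝ)
    (hw : ∀ i, 0 ≤ w i) (hw' : ∀ i, w i ≤ 1 / 4)
    (h : ∀ (S : Finset ι) i,
      (#{ω | E i ω ∧ ∀ j ∈ S, ¬ E j ω} : ℝ) ≤ 2 * w i * #{ω | ∀ j ∈ S, ¬ E j ω})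
    (S Z : Finset ι) :
    Real.exp (- (4 * ∑ j ∈ Z, w j)) * #{ω | ∀ j ∈ S, ¬ E j ω} ≤
      (#{ω | ∀ j ∈ S ∪ Z, ¬ E j ω} : ℝ) := by
  induction Z using Finset.induction_on with
  | empty => simp
  | insert a Z ha ih =>
    rw [sum_insert ha]
    have hs : (#{ω | ∀ j ∈ S ∪ Z, ¬ E j ω} : ℝ) ≤ #{ω | ∀ j ∈ S ∪ insert a Z, ¬ E j ω} +
        #{ω | E a ω ∧ ∀ j ∈ S ∪ Z, ¬ E j ω} := by
      have : ({ω | ∀ j ∈ S ∪ Z, ¬ E j ω} : Finset Ω) ⊆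
          ({ω | ∀ j ∈ S ∪ insert a Z, ¬ E j ω} : Finset Ω) ∪
          ({ω | E a ω ∧ ∀ j ∈ S ∪ Z, ¬ E j ω} : Finset Ω) := by
        intro ω hω
        simp only [mem_filter, mem_univ, true_and, mem_union, mem_insert] at hω ⊢
        by_cases hE : E a ω
        · exact Or.inr ⟨hE, hω⟩
        · left
          rintro j (hj | rfl | hj)
          · exact hω j (Or.inl hj)
          · exact hE
          · exact hω j (Or.inr hj)
      exact_mod_cast (card_le_card this).trans (card_union_le _ _)
    have h1 := h (S ∪ Z) a
    have h2 : Real.exp (- (4 * w a)) ≤ 1 - 2 * w a := by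
      have h3 := Real.add_one_le_exp (4 * w a)
      rw [Real.exp_neg, inv_le_comm₀ (Real.exp_pos _) (by linarith [hw' a])]
      refine le_trans ?_ h3
      rw [inv_le_iff_one_le_mul₀ (by linarith [hw' a])]
      nlinarith [hw a, hw' a]
    calc _ = Real.exp (- (4 * w a)) *
          (Real.exp (- (4 * ∑ j ∈ Z, w j)) * #{ω | ∀ j ∈ S, ¬ E j ω}) := by
          rw [← mul_assoc, ← Real.exp_add]; ring_nf
      _ ≤ (1 - 2 * w a) * #{ω | ∀ j ∈ S ∪ Z, ¬ E j ω} := by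
          gcongr
          linarith [hw' a]
      _ ≤ _ := by linarith

open Finset in
open Classical in
theorem card_perm_fixing_mul_descFactorial_le {V ι : Type*} [Fintype V]
    (p y : ι → V) (hy : Function.Injective y) (G : Finset (Equiv.Perm V))
    (hG : ∀ σ ∈ G, ∀ i, σ (p i) = y i → ∀ v, Equiv.swap (y i) v * σ ∈ G) (T : Finset ι) :
    #{σ ∈ G | ∀ i ∈ T, σ (p i) = y i} * (Fintype.card V).descFactorial #T ≤ #G := by
  induction T using Finset.induction_on with
  | empty => simp
  | insert a T ha ih =>
    rw [card_insert_of_notMem ha, Nat.descFactorial_succ, ← mul_assoc]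
    refine le_trans (Nat.mul_le_mul_right _ ?_) ih
    have hc : Fintype.card V - #T = #(univ \ T.image y) := by
      rw [card_sdiff_of_subset (subset_univ _), card_image_of_injective _ hy, card_univ]
    rw [hc, ← card_product]
    refine card_le_card_of_injOn (fun x => Equiv.swap (y a) x.2 * x.1) ?_ ?_
    · rintro ⟨σ, v⟩ hx
      simp only [coe_product, Set.mem_prod, mem_coe, mem_filter, mem_insert, mem_sdiff, mem_univ,
        true_and, mem_image, not_exists, not_and, forall_eq_or_imp] at hx ⊢
      obtain ⟨⟨hσ, ha', hT⟩, hv⟩ := hx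
      refine ⟨hG σ hσ a ha' v, fun i hi => ?_⟩
      rw [Equiv.Perm.mul_apply, hT i hi]
      refine Equiv.swap_apply_of_ne_of_ne (fun h => ha (hy h ▸ hi)) (hv i hi)
    · rintro ⟨σ, v⟩ hx ⟨σ', v'⟩ hx' h
      simp only [coe_product, Set.mem_prod, mem_coe, mem_filter, mem_insert,
        forall_eq_or_imp] at hx hx' h
      have h1 := congrArg (fun π : Equiv.Perm V => π (p a)) h
      simp only [Equiv.Perm.mul_apply, hx.1.2.1, hx'.1.2.1, Equiv.swap_apply_left] at h1
      subst h1
      simpa using h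

open Finset in
open Classical in
theorem card_perm_pair_fixing_mul_descFactorial_le {V W ι κ : Type*} [Fintype V] [Fintype W]
    [Fintype ι] [Fintype κ] (p y : ι → V) (q z : κ → W)
    (hy : Function.Injective y) (hz : Function.Injective z)
    (G : Finset (Equiv.Perm V × Equiv.Perm W))
    (hG : ∀ x ∈ G, ∀ i, x.1 (p i) = y i → ∀ v, (Equiv.swap (y i) v * x.1, x.2) ∈ G)
    (hG' : ∀ x ∈ G, ∀ i, x.2 (q i) = z i → ∀ v, (x.1, Equiv.swap (z i) v * x.2) ∈ G) :
    #{x ∈ G | (∀ i, x.1 (p i) = y i) ∧ ∀ i, x.2 (q i) = z i} *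
      ((Fintype.card V).descFactorial (Fintype.card ι) *
        (Fintype.card W).descFactorial (Fintype.card κ)) ≤ #G := by
  have key1 : #{x ∈ G | (∀ i, x.1 (p i) = y i) ∧ ∀ i, x.2 (q i) = z i} *
      (Fintype.card V).descFactorial (Fintype.card ι) ≤ #{x ∈ G | ∀ i, x.2 (q i) = z i} := by
    rw [card_eq_sum_card_fiberwise (f := Prod.snd) (t := univ) (fun _ _ => by simp),
      card_eq_sum_card_fiberwise (f := Prod.snd) (t := univ) (fun _ _ => by simp), sum_mul]
    refine sum_le_sum fun τ _ => ?_
    by_cases hτ : ∀ i, τ (q i) = z i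
    · have := card_perm_fixing_mul_descFactorial_le p y hy {σ | (σ, τ) ∈ G} (by
        intro σ hσ i hi v
        simp only [mem_filter, mem_univ, true_and] at hσ ⊢
        exact hG _ hσ i hi v) univ
      rw [card_univ] at this
      refine le_trans (Nat.mul_le_mul_right _ ?_) (this.trans ?_)
      · refine card_le_card_of_injOn Prod.fst ?_ ?_
        · rintro ⟨σ, τ'⟩ hx
          simp only [coe_filter, mem_filter, Set.mem_ofPred_eq, mem_univ, true_and,
            forall_const] at hx ⊢
          obtain ⟨⟨h1, h2, h3⟩, rfl⟩ := hx
          exact ⟨h1, h2⟩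
        · rintro ⟨σ, τ'⟩ hx ⟨σ', τ''⟩ hx' h
          simp only [coe_filter, Set.mem_ofPred_eq] at hx hx' h
          simp [h, hx.2, hx'.2]
      · refine card_le_card_of_injOn (fun σ => (σ, τ)) ?_ ?_
        · intro σ hσ
          simp only [coe_filter, mem_filter, Set.mem_ofPred_eq, mem_univ, true_and, and_true] at hσ ⊢
          exact ⟨hσ, hτ⟩
        · intro σ _ σ' _ h
          simpa using h
    · rw [card_eq_zero.2, zero_mul]
      · exact Nat.zero_le _
      · rw [filter_eq_empty_iff]
        rintro ⟨σ, τ'⟩ hx rfl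
        exact hτ (mem_filter.1 hx).2.2
  have key2 : #{x ∈ G | ∀ i, x.2 (q i) = z i} *
      (Fintype.card W).descFactorial (Fintype.card κ) ≤ #G := by
    rw [card_eq_sum_card_fiberwise (f := Prod.fst) (t := univ) (fun _ _ => by simp),
      card_eq_sum_card_fiberwise (s := G) (f := Prod.fst) (t := univ) (fun _ _ => by simp), sum_mul]
    refine sum_le_sum fun σ _ => ?_
    have := card_perm_fixing_mul_descFactorial_le q z hz {τ | (σ, τ) ∈ G} (by
        intro τ hτ i hi v
        simp only [mem_filter, mem_univ, true_and] at hτ ⊢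
        exact hG' _ hτ i hi v) univ
    rw [card_univ] at this
    refine le_trans (Nat.mul_le_mul_right _ ?_) (this.trans ?_)
    · refine card_le_card_of_injOn Prod.snd ?_ ?_
      · rintro ⟨σ', τ⟩ hx
        simp only [coe_filter, mem_filter, Set.mem_ofPred_eq, mem_univ, true_and,
          forall_const] at hx ⊢
        obtain ⟨⟨h1, h2⟩, rfl⟩ := hx
        exact ⟨h1, h2⟩
      · rintro ⟨σ, τ'⟩ hx ⟨σ', τ''⟩ hx' h
        simp only [coe_filter, Set.mem_ofPred_eq] at hx hx' h
        simp [h, hx.2, hx'.2]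
    · refine card_le_card_of_injOn (fun τ => (σ, τ)) ?_ ?_
      · intro τ hτ
        simp only [coe_filter, Set.mem_ofPred_eq, mem_univ, true_and, and_true] at hτ ⊢
        exact hτ
      · intro σ _ σ' _ h
        simpa using h
  calc _ = (#{x ∈ G | (∀ i, x.1 (p i) = y i) ∧ ∀ i, x.2 (q i) = z i} *
      (Fintype.card V).descFactorial (Fintype.card ι)) *
        (Fintype.card W).descFactorial (Fintype.card κ) := by ring
    _ ≤ _ := (Nat.mul_le_mul_right _ key1).trans key2

open Finset in
theorem sum_perm_image_mul_choose {J : Type*} [Fintype J] [DecidableEq J] (A₀ : Finset J) (F : Finset J → ℝ) :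
    (∑ π : Equiv.Perm J, F (A₀.image π)) * (Fintype.card J).choose #A₀ =
      (Fintype.card J).factorial * ∑ A ∈ powersetCard #A₀ univ, F A := by
  have hc : ∀ A ∈ powersetCard #A₀ (univ : Finset J),
      #{π : Equiv.Perm J | A₀.image π = A} = #{π : Equiv.Perm J | A₀.image π = A₀} := by
    intro A hA
    have hcard : #A₀ = #A := (mem_powersetCard.1 hA).2.symm
    let e : {x // x ∈ A₀} ≃ {x // x ∈ A} := Finset.equivOfCardEq hcard
    let ρ : Equiv.Perm J := e.extendSubtype
    have hρ : A₀.image ρ = A := by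
      refine eq_of_subset_of_card_le ?_ ?_
      · intro x hx
        obtain ⟨y, hy, rfl⟩ := mem_image.1 hx
        exact e.extendSubtype_mem y hy
      · rw [card_image_of_injective _ ρ.injective, hcard]
    refine card_bij' (fun π _ => ρ⁻¹ * π) (fun π _ => ρ * π) ?_ ?_ ?_ ?_
    · intro π hπ
      simp only [mem_filter, mem_univ, true_and] at hπ ⊢
      rw [Equiv.Perm.coe_mul, ← image_image, hπ, ← hρ, image_image, ← Equiv.Perm.coe_mul]
      simp
    · intro π hπ
      simp only [mem_filter, mem_univ, true_and] at hπ ⊢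
      rw [Equiv.Perm.coe_mul, ← image_image, hπ, hρ]
    · intro π _; simp
    · intro π _; simp
  have key : ∀ F : Finset J → ℝ, ∑ π : Equiv.Perm J, F (A₀.image π) =
      (#{π : Equiv.Perm J | A₀.image π = A₀} : ℝ) * ∑ A ∈ powersetCard #A₀ univ, F A := by
    intro F
    rw [← sum_fiberwise_of_maps_to (t := powersetCard #A₀ univ)
      (g := fun π : Equiv.Perm J => A₀.image π), mul_sum]
    · refine sum_congr rfl fun A hA => ?_
      rw [← hc A hA, ← nsmul_eq_mul, ← sum_const]
      refine sum_congr rfl fun π hπ => ?_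
      rw [(mem_filter.1 hπ).2]
    · intro π _
      simp [mem_powersetCard, card_image_of_injective _ π.injective]
  have h1 := key fun _ => 1
  simp only [sum_const, card_univ, Fintype.card_perm, card_powersetCard, nsmul_eq_mul,
    mul_one] at h1
  rw [key F, h1]
  ring

theorem exp_neg_le_one_sub_add_sq {x : ℝ} (hx : 0 ≤ x) : Real.exp (-x) ≤ 1 - x + x ^ 2 := by
  have h := Real.add_one_le_exp x
  rw [Real.exp_neg, inv_le_comm₀ (Real.exp_pos _) (by nlinarith [sq_nonneg (x - 1)])]
  refine le_trans ?_ h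
  rw [inv_le_iff_one_le_mul₀ (by nlinarith [sq_nonneg (x - 1)])]
  nlinarith [pow_nonneg hx 3]

open Finset in
theorem card_sparse_sample_le {V : Type*} [Fintype V] [DecidableEq V] (b u : ℕ) (L : Finset (Finset V))
    (p β : ℝ) (hβ : 0 ≤ β) (hp : p ≤ 1)
    (hL : p * (Fintype.card V : ℝ) ^ u = #{h : Fin u → V | univ.image h ∈ L}) :
    (#{f : Fin b × Fin u → V |
        (#{A ∈ powersetCard u univ | A.image f ∈ L} : ℝ) < (p - β) * (b * u).choose u} : ℝ) ≤
      Real.exp (- (b * β ^ 2 / 4)) * (Fintype.card V : ℝ) ^ (b * u) := by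
  set N : ℝ := (Fintype.card V : ℝ) with hN
  set l : ℝ := β / 2 with hl
  have hl0 : 0 ≤ l := by positivity
  let blk : Fin b → Finset (Fin b × Fin u) := fun j => univ.image fun a => (j, a)
  have hblk : ∀ j, #(blk j) = u := fun j => by
    rw [card_image_of_injective _ (fun a a' h => by simpa using h), card_univ, Fintype.card_fin]
  let ind : Finset V → ℝ := fun A => if A ∈ L then 1 else 0
  let Z : (Fin b × Fin u → V) → ℝ := fun f => ∑ j, ind ((blk j).image f)
  have hJ : Fintype.card (Fin b × Fin u) = b * u := by simp
  have hC : 0 < ((b * u).choose u : ℝ) ∨ b = 0 := by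
    rcases Nat.eq_zero_or_pos b with h | h
    · exact Or.inr h
    · left; exact_mod_cast Nat.choose_pos (Nat.le_mul_of_pos_left u h)
  rcases hC with hC | rfl
  swap
  · simp only [Nat.cast_zero, zero_mul, zero_div, neg_zero, Real.exp_zero, one_mul, pow_zero]
    refine le_trans (Nat.cast_le.2 (card_le_univ _)) ?_
    simp
  -- the average of `Z` over the permutations of the coordinates is controlled by the count
  have hZavg : ∀ f : Fin b × Fin u → V,
      (∑ π : Equiv.Perm (Fin b × Fin u), Z (f ∘ π)) * (b * u).choose u =
        (b * u).factorial * (b * #{A ∈ powersetCard u univ | A.image f ∈ L}) := by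
    intro f
    simp only [Z]
    rw [sum_comm, sum_mul]
    have : ∀ j, (∑ π : Equiv.Perm (Fin b × Fin u), ind ((blk j).image (f ∘ π))) *
        (b * u).choose u =
          (b * u).factorial * #{A ∈ powersetCard u univ | A.image f ∈ L} := by
      intro j
      have h := sum_perm_image_mul_choose (blk j) (fun A => ind (A.image f))
      rw [hblk, hJ] at h
      simp only [image_image] at h
      rw [h]
      simp [ind]
    rw [sum_congr rfl fun j _ => this j]
    simp only [sum_const, card_univ, Fintype.card_fin, nsmul_eq_mul]
    ring
  have hfact : (0 : ℝ) < (b * u).factorial := by exact_mod_cast Nat.factorial_pos _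
  set a : ℝ := -(l * (b * (p - β))) with ha
  have hlow : ∀ f : Fin b × Fin u → V,
      (#{A ∈ powersetCard u univ | A.image f ∈ L} : ℝ) < (p - β) * (b * u).choose u →
      (b * u).factorial * Real.exp a ≤
        ∑ π : Equiv.Perm (Fin b × Fin u), Real.exp (-(l * Z (f ∘ π))) := by
    intro f hf
    have h1 : ∑ π : Equiv.Perm (Fin b × Fin u), Z (f ∘ π) ≤
        (b * u).factorial * (b * (p - β)) := by
      refine le_of_mul_le_mul_right ?_ hC
      rw [hZavg]
      have : (b : ℝ) * #{A ∈ powersetCard u univ | A.image f ∈ L} ≤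
          b * ((p - β) * (b * u).choose u) := by gcongr
      calc _ ≤ ((b * u).factorial : ℝ) * (b * ((p - β) * (b * u).choose u)) := by gcongr
        _ = _ := by ring
    have h2 : ∀ π : Equiv.Perm (Fin b × Fin u),
        Real.exp a * (1 + (-(l * Z (f ∘ π)) - a)) ≤ Real.exp (-(l * Z (f ∘ π))) := by
      intro π
      have h := Real.add_one_le_exp (-(l * Z (f ∘ π)) - a)
      calc _ ≤ Real.exp a * Real.exp (-(l * Z (f ∘ π)) - a) := by gcongr; linarith
        _ = _ := by rw [← Real.exp_add]; ring_nf
    refine le_trans ?_ (sum_le_sum fun π _ => h2 π)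
    rw [← mul_sum, sum_add_distrib, sum_sub_distrib, sum_neg_distrib, ← mul_sum]
    simp only [sum_const, card_univ, Fintype.card_perm, hJ, nsmul_eq_mul, mul_one]
    have h3 : l * ∑ π : Equiv.Perm (Fin b × Fin u), Z (f ∘ π) ≤
        l * ((b * u).factorial * (b * (p - β))) := by gcongr
    have h4 : 0 ≤ -(l * ∑ π : Equiv.Perm (Fin b × Fin u), Z (f ∘ π)) - (b * u).factorial * a := by
      rw [ha]; linarith
    nlinarith [Real.exp_pos a]
  have hprod : ∑ f : Fin b × Fin u → V, Real.exp (-(l * Z f)) =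
      (∑ h : Fin u → V, Real.exp (-(l * ind (univ.image h)))) ^ b := by
    rw [Fintype.sum_pow]
    refine Fintype.sum_equiv (Equiv.curry _ _ _) _ _ fun f => ?_
    rw [← Real.exp_sum]
    congr 1
    simp only [Z, mul_sum, ← sum_neg_distrib]
    refine sum_congr rfl fun j _ => ?_
    simp only [blk, image_image]
    rfl
  have hone : ∑ h : Fin u → V, Real.exp (-(l * ind (univ.image h))) ≤
      N ^ u * Real.exp (- (p * (l - l ^ 2))) := by
    have h1 : ∀ h : Fin u → V, Real.exp (-(l * ind (univ.image h))) ≤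
        1 - (l - l ^ 2) * (if univ.image h ∈ L then 1 else 0) := by
      intro h
      simp only [ind]
      split_ifs
      · have := exp_neg_le_one_sub_add_sq hl0
        simp only [mul_one]; linarith
      · simp
    refine (sum_le_sum fun h _ => h1 h).trans ?_
    rw [sum_sub_distrib, ← mul_sum]
    simp only [sum_boole, sum_const, card_univ, nsmul_eq_mul, mul_one, Fintype.card_fun,
      Fintype.card_fin, Nat.cast_pow, ← hL]
    have := Real.add_one_le_exp (- (p * (l - l ^ 2)))
    have hNu : 0 ≤ N ^ u := by positivity
    nlinarith
  have hmain : (#{f : Fin b × Fin u → V |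
        (#{A ∈ powersetCard u univ | A.image f ∈ L} : ℝ) < (p - β) * (b * u).choose u} : ℝ) *
        ((b * u).factorial * Real.exp a) ≤
      (b * u).factorial * (N ^ u * Real.exp (- (p * (l - l ^ 2)))) ^ b := by
    calc _ = ∑ f : Fin b × Fin u → V with
            (#{A ∈ powersetCard u univ | A.image f ∈ L} : ℝ) < (p - β) * (b * u).choose u,
            ((b * u).factorial * Real.exp a) := by rw [sum_const, nsmul_eq_mul]
      _ ≤ ∑ f : Fin b × Fin u → V with
            (#{A ∈ powersetCard u univ | A.image f ∈ L} : ℝ) < (p - β) * (b * u).choose u,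
            ∑ π : Equiv.Perm (Fin b × Fin u), Real.exp (-(l * Z (f ∘ π))) :=
          sum_le_sum fun f hf => hlow f (mem_filter.1 hf).2
      _ ≤ ∑ f : Fin b × Fin u → V,
            ∑ π : Equiv.Perm (Fin b × Fin u), Real.exp (-(l * Z (f ∘ π))) :=
          sum_le_sum_of_subset_of_nonneg (filter_subset _ _) fun _ _ _ =>
            sum_nonneg fun _ _ => (Real.exp_pos _).le
      _ = ∑ π : Equiv.Perm (Fin b × Fin u), ∑ f : Fin b × Fin u → V,
            Real.exp (-(l * Z f)) := by
          rw [sum_comm]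
          refine sum_congr rfl fun π _ => ?_
          exact Fintype.sum_equiv (Equiv.arrowCongr π.symm (Equiv.refl V)) _ _ fun f => by
            congr 1
      _ = (b * u).factorial * (∑ h : Fin u → V, Real.exp (-(l * ind (univ.image h)))) ^ b := by
          rw [sum_const, card_univ, Fintype.card_perm, hJ, nsmul_eq_mul, hprod]
      _ ≤ _ := by gcongr
  have h5 : (#{f : Fin b × Fin u → V |
        (#{A ∈ powersetCard u univ | A.image f ∈ L} : ℝ) < (p - β) * (b * u).choose u} : ℝ) *
        Real.exp a ≤ (N ^ u * Real.exp (- (p * (l - l ^ 2)))) ^ b := by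
    refine le_of_mul_le_mul_left ?_ hfact
    calc _ = _ := by ring
      _ ≤ _ := hmain
  have h6 : (N ^ u * Real.exp (- (p * (l - l ^ 2)))) ^ b ≤
      Real.exp (- (b * β ^ 2 / 4)) * N ^ (b * u) * Real.exp a := by
    rw [mul_pow, ← pow_mul, ← Real.exp_nat_mul, mul_comm u b, mul_assoc, mul_left_comm,
      ← Real.exp_add]
    gcongr
    rw [ha, hl]
    have : (b : ℝ) * (β ^ 2 * p) ≤ b * (β ^ 2 * 1) := by gcongr
    nlinarith
  exact le_of_mul_le_mul_right (h5.trans h6) (Real.exp_pos a)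

open Finset in
theorem card_fun_apply_eq_mul_card {X V : Type*} [Fintype X] [Fintype V] [DecidableEq X]
    [DecidableEq V] (x₀ : X) (v : V) :
    #{r : X → V | r x₀ = v} * Fintype.card V = Fintype.card V ^ Fintype.card X := by
  have h : ({r : X → V | r x₀ = v} : Finset (X → V)) =
      Fintype.piFinset fun x => if x = x₀ then {v} else univ := by
    ext r
    simp only [mem_filter, mem_univ, true_and, Fintype.mem_piFinset]
    refine ⟨fun h x => ?_, fun h => by simpa using h x₀⟩
    split_ifs with hx
    · simp [hx, h]
    · simp
  rw [h, Fintype.card_piFinset, ← mul_prod_erase univ _ (mem_univ x₀),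
    prod_congr rfl (g := fun _ => Fintype.card V) fun x hx => by
      rw [if_neg (ne_of_mem_erase hx), card_univ]]
  simp only [↓reduceIte, card_singleton, one_mul, prod_const, card_erase_of_mem (mem_univ x₀),
    card_univ]
  rw [← pow_succ, Nat.sub_add_cancel (Fintype.card_pos_iff.2 ⟨x₀⟩)]

open Finset in
theorem card_fun_of_card_extend_le {B J V : Type*} [Fintype B] [Fintype J] [Fintype V]
    [DecidableEq B] [DecidableEq J] [DecidableEq V] (φ : J ↪ B) (p : B) (hp : p ∉ Set.range φ) (v : V) (P : (B → V) → Prop)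
    [DecidablePred P] (K : ℝ)
    (hK : ∀ g : B → V, (#{h : J → V | P (Function.extend φ h g)} : ℝ) ≤ K) :
    (#{f : B → V | P f ∧ f p = v} : ℝ) * Fintype.card V * (Fintype.card V : ℝ) ^ Fintype.card J ≤
      K * (Fintype.card V : ℝ) ^ Fintype.card B := by
  let X := {x : B // x ∉ Set.range φ}
  have hX : Fintype.card X + Fintype.card J = Fintype.card B := by
    have h1 := Fintype.card_subtype_compl (fun x => x ∈ Set.range φ)
    have h2 : Fintype.card {x // x ∈ Set.range φ} = Fintype.card J :=
      (Fintype.card_congr (Equiv.ofInjective φ φ.injective)).symm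
    have h3 := Fintype.card_le_of_embedding φ
    simp only [X]
    omega
  have h1 : (#{f : B → V | P f ∧ f p = v} : ℝ) ≤ #{r : X → V | r ⟨p, hp⟩ = v} * K := by
    rw [card_eq_sum_card_fiberwise (f := fun f : B → V => fun x : X => f x)
      (t := {r : X → V | r ⟨p, hp⟩ = v})]
    · rw [Nat.cast_sum, ← nsmul_eq_mul]
      refine sum_le_card_nsmul _ _ _ fun r _ => ?_
      let g : B → V := fun x => if hx : x ∉ Set.range φ then r ⟨x, hx⟩ else v
      refine le_trans ?_ (hK g)
      have hext : ∀ f : B → V, (fun x : X => f x) = r →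
          Function.extend φ (fun j => f (φ j)) g = f := by
        intro f hf
        ext x
        by_cases hx : x ∈ Set.range φ
        · obtain ⟨j, rfl⟩ := hx
          rw [φ.injective.extend_apply]
        · rw [Function.extend_apply' _ _ _ hx]
          simp only [g, dif_pos hx, ← hf]
      rw [Nat.cast_le]
      refine card_le_card_of_injOn (fun f j => f (φ j)) ?_ ?_
      · intro f hf
        simp only [coe_filter, mem_filter, mem_univ, true_and, Set.mem_ofPred_eq] at hf ⊢
        rw [hext f hf.2]
        exact hf.1.1
      · intro f hf f' hf' h
        simp only [coe_filter, mem_filter, mem_univ, true_and, Set.mem_ofPred_eq] at hf hf' h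
        rw [← hext f hf.2, ← hext f' hf'.2, h]
    · intro f hf
      simp only [coe_filter, mem_univ, true_and, Set.mem_ofPred_eq] at hf ⊢
      exact hf.2
  have h2 : (#{r : X → V | r ⟨p, hp⟩ = v} : ℝ) * Fintype.card V =
      (Fintype.card V : ℝ) ^ Fintype.card X := by
    exact_mod_cast card_fun_apply_eq_mul_card (X := X) ⟨p, hp⟩ v
  calc _ ≤ (#{r : X → V | r ⟨p, hp⟩ = v} * K) * Fintype.card V *
        (Fintype.card V : ℝ) ^ Fintype.card J := by gcongr
    _ = K * ((#{r : X → V | r ⟨p, hp⟩ = v} : ℝ) * Fintype.card V) *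
        (Fintype.card V : ℝ) ^ Fintype.card J := by ring
    _ = _ := by rw [h2, mul_assoc, ← pow_add, hX]

open Finset in
/-- The link of a vertex set `S` in a hypergraph `H`. -/
def hypergraphLink {V : Type*} [Fintype V] [DecidableEq V] (H : Finset (Finset V))
    (S : Finset V) : Finset (Finset V) :=
  {A | Disjoint A S ∧ A ∪ S ∈ H}

open Finset in
theorem card_hypergraphLink {V : Type*} [Fintype V] [DecidableEq V] (H : Finset (Finset V))
    (S : Finset V) : #(hypergraphLink H S) = #{e ∈ H | S ⊆ e} := by
  refine card_bij' (fun A _ => A ∪ S) (fun e _ => e \ S) ?_ ?_ ?_ ?_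
  · intro A hA
    simp only [hypergraphLink, mem_filter, mem_univ, true_and] at hA ⊢
    exact ⟨hA.2, subset_union_right⟩
  · intro e he
    simp only [hypergraphLink, mem_filter, mem_univ, true_and] at he ⊢
    exact ⟨sdiff_disjoint, by rw [sdiff_union_of_subset he.2]; exact he.1⟩
  · intro A hA
    simp only [hypergraphLink, mem_filter, mem_univ, true_and] at hA
    exact union_sdiff_cancel_right hA.1
  · intro e he
    exact sdiff_union_of_subset (mem_filter.1 he).2

open Finset in
theorem factorial_mul_card_le_card_image_mem {V : Type*} [Fintype V] [DecidableEq V] (u : ℕ)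
    (L : Finset (Finset V)) (hL : ∀ A ∈ L, #A = u) :
    u.factorial * #L ≤ #{h : Fin u → V | univ.image h ∈ L} := by
  have hex : ∀ A : L, ∃ h : Fin u → V, Function.Injective h ∧ univ.image h = A := by
    rintro ⟨A, hA⟩
    let e := (Finset.equivFinOfCardEq (hL A hA)).symm
    refine ⟨fun i => e i, fun i j h => e.injective (Subtype.ext h), ?_⟩
    ext x
    simp only [mem_image, mem_univ, true_and]
    refine ⟨?_, fun hx => ⟨e.symm ⟨x, hx⟩, by simp⟩⟩
    rintro ⟨i, rfl⟩
    exact (e i).2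
  choose e he using hex
  have hcard : u.factorial * #L = #((univ : Finset (Equiv.Perm (Fin u))) ×ˢ L.attach) := by
    rw [card_product, card_univ, Fintype.card_perm, Fintype.card_fin, card_attach]
  rw [hcard]
  refine card_le_card_of_injOn (fun x => e x.2 ∘ x.1) ?_ ?_
  · rintro ⟨π, A⟩ -
    simp only [coe_filter, mem_univ, true_and, Set.mem_ofPred_eq]
    rw [← image_image, image_univ_equiv, (he A).2]
    exact A.2
  · rintro ⟨π, A⟩ - ⟨π', A'⟩ - h
    have h1 := congrArg (fun f : Fin u → V => univ.image f) h
    simp only [← image_image, image_univ_equiv, (he A).2, (he A').2] at h1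
    obtain rfl := Subtype.ext h1
    simp only [Prod.mk.injEq, and_true]
    ext i
    exact congrArg Fin.val ((he A).1 (congrFun h i))

open Finset in
theorem card_image_mem_link_le {B J V : Type*} [Fintype B] [Fintype J] [Fintype V]
    [DecidableEq V] [DecidableEq J] (H : Finset (Finset V)) (f : B → V)
    (hf : Function.Injective f) (D : Finset B) (φ : J ↪ B)
    (u : ℕ) :
    #{A ∈ powersetCard u (univ : Finset J) | A.image (f ∘ φ) ∈ hypergraphLink H (D.image f)} ≤
      #{e ∈ H | D.image f ⊆ e ∧ e ⊆ univ.image f} := by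
  refine card_le_card_of_injOn (fun A => A.image (f ∘ φ) ∪ D.image f) ?_ ?_
  · intro A hA
    simp only [hypergraphLink, coe_filter, mem_filter, mem_univ, true_and,
      Set.mem_ofPred_eq] at hA ⊢
    refine ⟨hA.2.2, subset_union_right, union_subset ?_ (image_subset_image (subset_univ _))⟩
    intro x hx
    obtain ⟨j, _, rfl⟩ := mem_image.1 hx
    exact mem_image_of_mem _ (mem_univ _)
  · intro A hA A' hA' h
    simp only [hypergraphLink, coe_filter, mem_filter, mem_univ, true_and,
      Set.mem_ofPred_eq] at hA hA' h
    have h1 := congrArg (· \ D.image f) h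
    simp only [union_sdiff_cancel_right hA.2.1, union_sdiff_cancel_right hA'.2.1] at h1
    exact image_injective (hf.comp φ.injective) h1

open Finset in
/-- The `f`-image of `D` lies in fewer than `t` edges of `H` contained in the image of `f`. -/
def IsDeficientOn {B V : Type*} [Fintype B] [DecidableEq V] (H : Finset (Finset V)) (t : ℝ)
    (D : Finset B) (f : B → V) : Prop :=
  Function.Injective f ∧ (#{e ∈ H | D.image f ⊆ e ∧ e ⊆ univ.image f} : ℝ) < t

open Finset in
open Classical in
theorem card_deficient_block_le {B V : Type*} [Fintype B] [Fintype V] [DecidableEq B]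
    [DecidableEq V]
    (H : Finset (Finset V)) (d u b : ℕ) (γ ρ β η : ℝ) (hβ : 0 ≤ β)
    (hH : ∀ e ∈ H, #e = d + u)
    (hdeg : ∀ D : Finset V, #D = d →
      ρ * (Fintype.card V : ℝ) ^ u ≤ u.factorial * (#{e ∈ H | D ⊆ e} : ℝ))
    (hb : d + 1 + b * u ≤ Fintype.card B)
    (hη : γ * ((Fintype.card B - d).choose u : ℝ) ≤ (ρ - β) * ((b * u).choose u : ℝ))
    (hε : Real.exp (- (b * β ^ 2 / 4)) ≤ η) (p : B) (v : V) :
    (#{f : B → V | (∃ D : Finset B, #D = d ∧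
        IsDeficientOn H (γ * ((Fintype.card B - d).choose u : ℝ)) D f) ∧ f p = v} : ℝ) * Fintype.card V ≤
      (Fintype.card B : ℝ) ^ d * η * (Fintype.card V : ℝ) ^ Fintype.card B := by
  set N : ℝ := (Fintype.card V : ℝ) with hN
  have hN0 : 0 < N := by
    rw [hN]; exact_mod_cast Fintype.card_pos_iff.2 ⟨v⟩
  have hD : ∀ D : Finset B, #D = d →
      (#{f : B → V | IsDeficientOn H (γ * ((Fintype.card B - d).choose u : ℝ)) D f ∧ f p = v} : ℝ) * N ≤
        η * N ^ Fintype.card B := by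
    intro D hDc
    obtain ⟨φ', hφ'⟩ : ∃ φ : Fin b × Fin u ↪ B, ∀ j, φ j ∉ insert p D := by
      have hc : Fintype.card (Fin b × Fin u) ≤ Fintype.card {x // x ∉ insert p D} := by
        have h1 : Fintype.card {x // x ∉ insert p D} = Fintype.card B - #(insert p D) := by
          rw [Fintype.card_subtype_compl (fun x => x ∈ insert p D), Fintype.card_coe]
        have h2 := card_insert_le p D
        rw [h1, Fintype.card_prod, Fintype.card_fin, Fintype.card_fin]
        omega
      obtain ⟨ψ⟩ := Function.Embedding.nonempty_of_card_le hc
      exact ⟨ψ.trans (Function.Embedding.subtype _), fun j => (ψ j).2⟩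
    have key := card_fun_of_card_extend_le φ' p
      (by rintro ⟨j, hj⟩; exact hφ' j (hj ▸ mem_insert_self _ _)) v
      (IsDeficientOn H (γ * ((Fintype.card B - d).choose u : ℝ)) D) (η * N ^ (b * u)) ?_
    · rw [Fintype.card_prod, Fintype.card_fin, Fintype.card_fin] at key
      refine le_of_mul_le_mul_right (key.trans_eq ?_) (pow_pos hN0 (b * u))
      ring
    intro g
    have hDg : ∀ h : Fin b × Fin u → V, D.image (Function.extend φ' h g) = D.image g := by
      intro h
      refine image_congr fun x hx => ?_
      rw [Function.extend_apply']
      rintro ⟨j, rfl⟩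
      exact hφ' j (mem_insert_of_mem hx)
    by_cases hg : #(D.image g) = d
    swap
    · rw [card_eq_zero.2]
      · have : 0 ≤ η := (Real.exp_pos _).le.trans hε
        rw [Nat.cast_zero]; positivity
      · rw [filter_eq_empty_iff]
        rintro h _ ⟨hinj, _⟩
        rw [← hDg h, card_image_of_injective _ hinj] at hg
        exact hg hDc
    set L := hypergraphLink H (D.image g) with hL
    have hLu : ∀ A ∈ L, #A = u := by
      intro A hA
      simp only [hL, hypergraphLink, mem_filter, mem_univ, true_and] at hA
      have h1 := hH _ hA.2
      rw [card_union_of_disjoint hA.1, hg] at h1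
      omega
    set p' : ℝ := #{h : Fin u → V | univ.image h ∈ L} / N ^ u with hp'
    have hp'e : p' * N ^ u = #{h : Fin u → V | univ.image h ∈ L} := by
      rw [hp']; field_simp
    have hp'1 : p' ≤ 1 := by
      rw [hp', div_le_one (by positivity)]
      refine le_trans (Nat.cast_le.2 (card_le_univ _)) ?_
      simp [hN]
    have hρ : ρ ≤ p' := by
      rw [hp', le_div_iff₀ (by positivity)]
      refine (hdeg _ hg).trans ?_
      rw [← card_hypergraphLink]
      exact_mod_cast factorial_mul_card_le_card_image_mem u L hLu
    have hconc := card_sparse_sample_le b u L p' β hβ hp'1 hp'e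
    refine le_trans ?_ (hconc.trans (by gcongr))
    rw [Nat.cast_le]
    refine card_le_card (monotone_filter_right _ fun h _ hh => ?_)
    obtain ⟨hinj, hlt⟩ := hh
    have h1 := card_image_mem_link_le H _ hinj D φ' u
    have h2 : (Function.extend φ' h g) ∘ φ' = h := Function.extend_comp φ'.injective _ _
    rw [h2, hDg h] at h1
    have h3 : (ρ - β) * ((b * u).choose u : ℝ) ≤ (p' - β) * ((b * u).choose u : ℝ) := by gcongr
    refine lt_of_le_of_lt ?_ (hlt.trans_le (hη.trans h3))
    rw [hDg h]
    exact_mod_cast h1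
  have hun : (#{f : B → V | (∃ D : Finset B, #D = d ∧
        IsDeficientOn H (γ * ((Fintype.card B - d).choose u : ℝ)) D f) ∧ f p = v} : ℝ) ≤
      ∑ D ∈ powersetCard d (univ : Finset B), (#{f : B → V | IsDeficientOn H (γ * ((Fintype.card B - d).choose u : ℝ)) D f ∧ f p = v} : ℝ) := by
    refine le_trans (Nat.cast_le.2 (card_le_card (t := (powersetCard d (univ : Finset B)).biUnion
      fun D => {f : B → V | IsDeficientOn H (γ * ((Fintype.card B - d).choose u : ℝ)) D f ∧ f p = v}) ?_)) ?_
    · intro f hf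
      simp only [mem_filter, mem_univ, true_and, mem_biUnion, mem_powersetCard,
        subset_univ] at hf ⊢
      obtain ⟨⟨D, hDc, hdef⟩, hv⟩ := hf
      exact ⟨D, hDc, hdef, hv⟩
    · exact_mod_cast card_biUnion_le
  have h0 : 0 ≤ η := (Real.exp_pos _).le.trans hε
  calc _ ≤ (∑ D ∈ powersetCard d (univ : Finset B), (#{f : B → V | IsDeficientOn H (γ * ((Fintype.card B - d).choose u : ℝ)) D f ∧ f p = v} : ℝ)) * N := by gcongr
    _ ≤ ∑ D ∈ powersetCard d (univ : Finset B), η * N ^ Fintype.card B := by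
        rw [sum_mul]
        exact sum_le_sum fun D hD' => hD D (mem_powersetCard.1 hD').2
    _ = ((Fintype.card B).choose d : ℝ) * (η * N ^ Fintype.card B) := by
        rw [sum_const, card_powersetCard, card_univ, nsmul_eq_mul]
    _ ≤ (Fintype.card B : ℝ) ^ d * (η * N ^ Fintype.card B) := by
        gcongr
        exact_mod_cast Nat.choose_le_pow _ _
    _ = _ := by ring

open Finset in
open Classical in
theorem sum_filter_or_le {ι : Type*} (s : Finset ι) (w : ι → ℝ) (hw : ∀ i, 0 ≤ w i)
    (P Q : ι → Prop) :
    ∑ i ∈ s with P i ∨ Q i, w i ≤ ∑ i ∈ s with P i, w i + ∑ i ∈ s with Q i, w i := by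
  simp only [sum_filter, ← sum_add_distrib]
  refine sum_le_sum fun i _ => ?_
  have := hw i
  by_cases hP : P i <;> by_cases hQ : Q i <;> simp [hP, hQ, this]

open Finset in
open Classical in
theorem sum_filter_exists_le {ι κ : Type*} [Fintype κ] (s : Finset ι) (w : ι → ℝ)
    (hw : ∀ i, 0 ≤ w i) (P : κ → ι → Prop) :
    ∑ i ∈ s with ∃ k, P k i, w i ≤ ∑ k, ∑ i ∈ s with P k i, w i := by
  simp only [sum_filter]
  rw [sum_comm]
  refine sum_le_sum fun i _ => ?_
  have h0 : ∀ k, 0 ≤ if P k i then w i else 0 := fun k => by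
    split_ifs
    exacts [hw i, le_rfl]
  split_ifs with h
  · obtain ⟨k, hk⟩ := h
    refine le_trans ?_ (single_le_sum (fun k _ => h0 k) (mem_univ k))
    rw [if_pos hk]
  · exact sum_nonneg fun k _ => h0 k

theorem Equiv.Perm.apply_eq_of_swap_mul_apply_eq {V : Type*} [DecidableEq V] {σ : Equiv.Perm V}
    {p x v₀ v t : V} (hp : σ p = v₀) (hx : x ≠ p) (ht : t ≠ v₀)
    (h : (Equiv.swap v₀ v * σ) x = t) : σ x = t := by
  rw [Equiv.Perm.mul_apply] at h
  have h1 : σ x ≠ v₀ := fun h' => hx (σ.injective (h'.trans hp.symm))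
  have h2 : σ x ≠ v := fun h' => ht (by rw [← h, h', Equiv.swap_apply_right])
  rwa [Equiv.swap_apply_of_ne_of_ne h1 h2] at h

section BadBlocks

variable {V W I : Type*}

/-- A way in which the `j`-th position can witness a bad block: the vertices placed on the block
containing `j` and the color placed on `j`. -/
abbrev BlockPattern (a : V → I) (b : W → I) : Type _ := Σ j : W, ({x // a x = b j} → V) × W

/-- The event that a pair of permutations realizes a bad pattern. -/
def PatternOccurs (a : V → I) (b : W → I) (Bd : ∀ i, ({x // a x = i} → V) → W → Prop)
    (e : BlockPattern a b) (ω : Equiv.Perm V × Equiv.Perm W) : Prop :=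
  Bd (b e.1) e.2.1 e.2.2 ∧ (∀ x : {x // a x = b e.1}, ω.1 x = e.2.1 x) ∧ ω.2 e.1 = e.2.2

open Classical in
/-- An upper bound for the probability that a random pair of permutations realizes a pattern. -/
noncomputable def patternWeight [Fintype V] [Fintype W] (a : V → I) (b : W → I)
    (Bd : ∀ i, ({x // a x = i} → V) → W → Prop) (e : BlockPattern a b) : ℝ :=
  if Bd (b e.1) e.2.1 e.2.2 then
    2 / ((Fintype.card V : ℝ) ^ Fintype.card {x // a x = b e.1} * Fintype.card W) else 0

open Classical in
theorem patternWeight_nonneg [Fintype V] [Fintype W] (a : V → I) (b : W → I)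
    (Bd : ∀ i, ({x // a x = i} → V) → W → Prop) (e : BlockPattern a b) :
    0 ≤ patternWeight a b Bd e := by
  unfold patternWeight
  split_ifs <;> positivity

open Finset in
open Classical in
theorem card_avoiding_fixing_le [Fintype V] [Fintype W] {ι κ : Type*}
    [Fintype ι] [Fintype κ] (a : V → I) (b : W → I)
    (Bd : ∀ i, ({x // a x = i} → V) → W → Prop)
    (p y : ι → V) (q z : κ → W) (hy : Function.Injective y) (hz : Function.Injective z)
    (S : Finset (BlockPattern a b))
    (h1 : ∀ e ∈ S, ∀ i, b e.1 ≠ a (p i)) (h2 : ∀ e ∈ S, ∀ i x, e.2.1 x ≠ y i)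
    (h3 : ∀ e ∈ S, ∀ j, b e.1 ≠ b (q j)) (h4 : ∀ e ∈ S, ∀ j, e.2.2 ≠ z j) :
    (#{ω : Equiv.Perm V × Equiv.Perm W | ((∀ i, ω.1 (p i) = y i) ∧ ∀ j, ω.2 (q j) = z j) ∧
        ∀ e ∈ S, ¬ PatternOccurs a b Bd e ω} : ℝ) *
      ((Fintype.card V).descFactorial (Fintype.card ι) *
        (Fintype.card W).descFactorial (Fintype.card κ)) ≤
      #{ω : Equiv.Perm V × Equiv.Perm W | ∀ e ∈ S, ¬ PatternOccurs a b Bd e ω} := by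
  have h := card_perm_pair_fixing_mul_descFactorial_le p y q z hy hz
    {ω : Equiv.Perm V × Equiv.Perm W | ∀ e ∈ S, ¬ PatternOccurs a b Bd e ω} ?_ ?_
  · rw [filter_filter] at h
    simp only [and_comm (a := ∀ e ∈ S, _)] at h
    exact_mod_cast h
  · intro ω hω i hi v
    simp only [mem_filter, mem_univ, true_and] at hω ⊢
    rintro e he ⟨hB, hV, hW⟩
    refine hω e he ⟨hB, fun x => ?_, hW⟩
    refine Equiv.Perm.apply_eq_of_swap_mul_apply_eq hi ?_ (h2 e he i x) (hV x)
    rintro hx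
    exact h1 e he i (by rw [← hx, x.2])
  · intro ω hω j hj v
    simp only [mem_filter, mem_univ, true_and] at hω ⊢
    rintro e he ⟨hB, hV, hW⟩
    refine hω e he ⟨hB, hV, ?_⟩
    refine Equiv.Perm.apply_eq_of_swap_mul_apply_eq hj ?_ (h4 e he j) hW
    rintro hx
    exact h3 e he j (by rw [← hx])

variable [Fintype V] [Fintype W] (a : V → I) (b : W → I)
  (Bd : ∀ i, ({x // a x = i} → V) → W → Prop)

open Finset in
open Classical in
theorem sum_patternWeight_fixed_le (ε : ℝ) (hV : 0 < Fintype.card V)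
    (hne : ∀ i, Nonempty {x // a x = i})
    (hbad : ∀ i c (p : {x // a x = i}) v,
      (#{f : {x // a x = i} → V | Bd i f c ∧ f p = v} : ℝ) * Fintype.card V ≤
        ε * (Fintype.card V : ℝ) ^ Fintype.card {x // a x = i}) (j c : W) :
    ∑ f : {x // a x = b j} → V, patternWeight a b Bd ⟨j, f, c⟩ ≤ 2 * ε / Fintype.card W := by
  obtain ⟨p⟩ := hne (b j)
  set N : ℝ := (Fintype.card V : ℝ) with hN
  have hN0 : 0 < N := by rw [hN]; exact_mod_cast hV
  have hW : (0 : ℝ) < Fintype.card W := by exact_mod_cast Fintype.card_pos_iff.2 ⟨j⟩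
  set l := Fintype.card {x // a x = b j} with hl
  have h1 : (#{f : {x // a x = b j} → V | Bd (b j) f c} : ℝ) ≤ ε * N ^ l := by
    have h2 : (#{f : {x // a x = b j} → V | Bd (b j) f c} : ℝ) =
        ∑ v : V, (#{f : {x // a x = b j} → V | Bd (b j) f c ∧ f p = v} : ℝ) := by
      rw [card_eq_sum_card_fiberwise (f := fun f => f p) (t := univ) (fun _ _ => by simp)]
      push_cast
      simp only [filter_filter]
    refine le_of_mul_le_mul_right ?_ hN0
    rw [h2, sum_mul]
    refine (sum_le_sum fun v _ => hbad (b j) c p v).trans ?_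
    rw [sum_const, card_univ, nsmul_eq_mul, mul_comm]
  calc _ = (#{f : {x // a x = b j} → V | Bd (b j) f c} : ℝ) *
        (2 / (N ^ l * Fintype.card W)) := by
        have h2 : ∀ f : {x // a x = b j} → V, patternWeight a b Bd ⟨j, f, c⟩ =
            if Bd (b j) f c then 2 / (N ^ l * Fintype.card W) else 0 := fun f => rfl
        simp only [h2]
        rw [← sum_filter, sum_const, nsmul_eq_mul]
    _ ≤ (ε * N ^ l) * (2 / (N ^ l * Fintype.card W)) := by gcongr
    _ = _ := by field_simp

open Finset in
open Classical in
theorem sum_patternWeight_block_le (ε : ℝ) (K : ℕ) (hε : 0 ≤ ε) (hV : 0 < Fintype.card V)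
    (hne : ∀ i, Nonempty {x // a x = i}) (hK : ∀ i, Fintype.card {y // b y = i} ≤ K)
    (hbad : ∀ i c (p : {x // a x = i}) v,
      (#{f : {x // a x = i} → V | Bd i f c ∧ f p = v} : ℝ) * Fintype.card V ≤
        ε * (Fintype.card V : ℝ) ^ Fintype.card {x // a x = i}) (i : I) :
    ∑ e : BlockPattern a b with b e.1 = i, patternWeight a b Bd e ≤ 2 * K * ε := by
  rw [sum_filter, Fintype.sum_sigma]
  have h1 : ∀ j : W, (∑ g : ({x // a x = b j} → V) × W,
      if b j = i then patternWeight a b Bd ⟨j, g⟩ else 0) ≤ if b j = i then 2 * ε else 0 := by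
    intro j
    split_ifs with hj
    · rw [Fintype.sum_prod_type_right]
      refine (sum_le_sum fun c _ =>
        sum_patternWeight_fixed_le a b Bd ε hV hne hbad j c).trans_eq ?_
      have hW : (0 : ℝ) < Fintype.card W := by exact_mod_cast Fintype.card_pos_iff.2 ⟨j⟩
      rw [sum_const, card_univ, nsmul_eq_mul]
      field_simp
    · simp
  refine (sum_le_sum fun j _ => h1 j).trans ?_
  rw [← sum_filter, sum_const, nsmul_eq_mul, ← Fintype.card_subtype]
  have : (Fintype.card {y // b y = i} : ℝ) ≤ K := by exact_mod_cast hK i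
  nlinarith

open Finset in
open Classical in
theorem sum_patternWeight_color_le (ε : ℝ) (hV : 0 < Fintype.card V)
    (hne : ∀ i, Nonempty {x // a x = i})
    (hbad : ∀ i c (p : {x // a x = i}) v,
      (#{f : {x // a x = i} → V | Bd i f c ∧ f p = v} : ℝ) * Fintype.card V ≤
        ε * (Fintype.card V : ℝ) ^ Fintype.card {x // a x = i}) (c : W) :
    ∑ e : BlockPattern a b with e.2.2 = c, patternWeight a b Bd e ≤ 2 * ε := by
  rw [sum_filter, Fintype.sum_sigma]
  have hW : (0 : ℝ) < Fintype.card W := by exact_mod_cast Fintype.card_pos_iff.2 ⟨c⟩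
  have h1 : ∀ j : W, (∑ g : ({x // a x = b j} → V) × W,
      if g.2 = c then patternWeight a b Bd ⟨j, g⟩ else 0) ≤ 2 * ε / Fintype.card W := by
    intro j
    rw [Fintype.sum_prod_type]
    simp only [sum_ite_eq', mem_univ, if_true]
    exact sum_patternWeight_fixed_le a b Bd ε hV hne hbad j c
  refine (sum_le_sum fun j _ => h1 j).trans_eq ?_
  rw [sum_const, card_univ, nsmul_eq_mul]
  field_simp

open Finset in
open Classical in
theorem sum_patternWeight_vertex_le (ε : ℝ) (K : ℕ) (hε : 0 ≤ ε) (hV : 0 < Fintype.card V)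
    (hK : ∀ i, Fintype.card {y // b y = i} ≤ K)
    (hbad : ∀ i c (p : {x // a x = i}) v,
      (#{f : {x // a x = i} → V | Bd i f c ∧ f p = v} : ℝ) * Fintype.card V ≤
        ε * (Fintype.card V : ℝ) ^ Fintype.card {x // a x = i}) (v : V) :
    ∑ e : BlockPattern a b with ∃ x, e.2.1 x = v, patternWeight a b Bd e ≤ 2 * K * ε := by
  rw [sum_filter, Fintype.sum_sigma]
  set N : ℝ := (Fintype.card V : ℝ) with hN
  have hN0 : 0 < N := by rw [hN]; exact_mod_cast hV
  have h1 : ∀ j : W, (∑ g : ({x // a x = b j} → V) × W,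
      if ∃ x, g.1 x = v then patternWeight a b Bd ⟨j, g⟩ else 0) ≤
        Fintype.card {x // a x = b j} * (2 * ε / N) := by
    intro j
    have hW : (0 : ℝ) < Fintype.card W := by exact_mod_cast Fintype.card_pos_iff.2 ⟨j⟩
    set l := Fintype.card {x // a x = b j} with hl
    rw [Fintype.sum_prod_type_right]
    have h2 : ∀ c : W, (∑ f : {x // a x = b j} → V,
        if ∃ x, f x = v then patternWeight a b Bd ⟨j, f, c⟩ else 0) ≤
          l * (2 * ε / N) / Fintype.card W := by
      intro c
      rw [← sum_filter]
      refine (sum_filter_exists_le _ _ (fun f => patternWeight_nonneg a b Bd ⟨j, f, c⟩) _).trans ?_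
      have h3 : ∀ x : {x // a x = b j}, ∑ f : {x // a x = b j} → V with f x = v,
          patternWeight a b Bd ⟨j, f, c⟩ ≤ 2 * ε / N / Fintype.card W := by
        intro x
        calc _ = (#{f : {x // a x = b j} → V | Bd (b j) f c ∧ f x = v} : ℝ) *
                (2 / (N ^ l * Fintype.card W)) := by
              have h4 : ∀ f : {x // a x = b j} → V, patternWeight a b Bd ⟨j, f, c⟩ =
                  if Bd (b j) f c then 2 / (N ^ l * Fintype.card W) else 0 := fun f => rfl
              simp only [h4]
              rw [← sum_filter, sum_const, nsmul_eq_mul, filter_filter]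
              simp only [and_comm]
          _ ≤ (ε * N ^ l / N) * (2 / (N ^ l * Fintype.card W)) := by
              gcongr
              rw [le_div_iff₀ hN0]
              exact hbad (b j) c x v
          _ = _ := by field_simp
      refine (sum_le_sum fun x _ => h3 x).trans_eq ?_
      rw [sum_const, card_univ, nsmul_eq_mul, ← hl]
      ring
    refine (sum_le_sum fun c _ => h2 c).trans_eq ?_
    rw [sum_const, card_univ, nsmul_eq_mul]
    field_simp
  refine (sum_le_sum fun j _ => h1 j).trans ?_
  rw [← sum_mul]
  have h4 : ∑ j : W, Fintype.card {x // a x = b j} ≤ Fintype.card V * K := by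
    simp only [Fintype.card_subtype]
    refine (sum_card_bipartiteAbove_eq_sum_card_bipartiteBelow
      (fun (x : V) (j : W) => a x = b j)).symm.trans_le ?_
    rw [← smul_eq_mul, ← card_univ (α := V)]
    refine sum_le_card_nsmul _ _ _ fun x _ => ?_
    refine le_trans (le_of_eq ?_) (hK (a x))
    rw [Fintype.card_subtype, bipartiteAbove]
    simp only [eq_comm]
  have h5 : (∑ j : W, (Fintype.card {x // a x = b j} : ℝ)) ≤ N * K := by
    rw [hN, ← Nat.cast_mul, ← Nat.cast_sum]
    exact Nat.cast_le.2 h4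
  calc _ ≤ (N * K) * (2 * ε / N) := by gcongr
    _ = _ := by field_simp

set_option maxHeartbeats 1000000 in
open Finset in
open Classical in
theorem exists_spread_avoiding_bad_blocks (ε : ℝ) (K : ℕ) (hε : 0 ≤ ε)
    (hV : 0 < Fintype.card V) (hW : 0 < Fintype.card W) (hK1 : 1 ≤ K)
    (hne : ∀ i, Nonempty {x // a x = i})
    (hKV : ∀ i, Fintype.card {x // a x = i} ≤ K) (hKW : ∀ i, Fintype.card {y // b y = i} ≤ K)
    (hdesc : ∀ i, Fintype.card V ^ Fintype.card {x // a x = i} ≤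
      2 * (Fintype.card V).descFactorial (Fintype.card {x // a x = i}))
    (hinj : ∀ i f c, Bd i f c → Function.Injective f)
    (hbad : ∀ i c (p : {x // a x = i}) v,
      (#{f : {x // a x = i} → V | Bd i f c ∧ f p = v} : ℝ) * Fintype.card V ≤
        ε * (Fintype.card V : ℝ) ^ Fintype.card {x // a x = i})
    (hsmall : 2 * K * ε * (K + 2) ≤ 1 / 8) :
    ∃ G : Finset (Equiv.Perm V × Equiv.Perm W), G.Nonempty ∧
      (∀ ω ∈ G, ∀ j, ¬ Bd (b j) (fun x => ω.1 x) (ω.2 j)) ∧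
      ∀ (r l : ℕ) (p y : Fin r → V) (q z : Fin l → W), Function.Injective y →
        Function.Injective z →
        (#{ω ∈ G | (∀ i, ω.1 (p i) = y i) ∧ ∀ j, ω.2 (q j) = z j} : ℝ) *
          ((Fintype.card V).descFactorial r * (Fintype.card W).descFactorial l) ≤
          Real.exp (r + l) * #G := by
  set w := patternWeight a b Bd with hw
  have hw0 : ∀ e, 0 ≤ w e := patternWeight_nonneg a b Bd
  have hT1 := sum_patternWeight_block_le a b Bd ε K hε hV hne hKW hbad
  have hT2 := sum_patternWeight_vertex_le a b Bd ε K hε hV hKW hbad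
  have hT3 : ∀ c, ∑ e : BlockPattern a b with e.2.2 = c, w e ≤ 2 * K * ε := fun c => by
    refine (sum_patternWeight_color_le a b Bd ε hV hne hbad c).trans ?_
    have : (1 : ℝ) ≤ K := by exact_mod_cast hK1
    nlinarith
  have hKε : 0 ≤ 2 * K * ε := by positivity
  have hKε' : 2 * K * ε ≤ 1 / 16 := by
    have : (0 : ℝ) ≤ 2 * K * ε * K := by positivity
    linarith
  let nb : BlockPattern a b → BlockPattern a b → Prop := fun e e' =>
    b e'.1 = b e.1 ∨ (∃ x, ∃ x', e'.2.1 x' = e.2.1 x) ∨ e'.2.2 = e.2.2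
  have hind : ∀ e (S : Finset (BlockPattern a b)), (∀ e' ∈ S, ¬ nb e e') →
      (#{ω | PatternOccurs a b Bd e ω ∧ ∀ e' ∈ S, ¬ PatternOccurs a b Bd e' ω} : ℝ) ≤
        w e * #{ω | ∀ e' ∈ S, ¬ PatternOccurs a b Bd e' ω} := by
    rintro ⟨j, f, c⟩ S hS
    simp only [nb, not_or, not_exists] at hS
    by_cases hB : Bd (b j) f c
    swap
    · rw [card_eq_zero.2]
      · rw [Nat.cast_zero]
        exact mul_nonneg (hw0 _) (Nat.cast_nonneg _)
      · rw [filter_eq_empty_iff]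
        rintro ω _ ⟨h, _⟩
        exact hB h.1
    have h := card_avoiding_fixing_le a b Bd (fun x : {x // a x = b j} => (x : V)) f
      (fun _ : Unit => j) (fun _ => c) (hinj _ _ _ hB) (fun _ _ _ => rfl) S
      (fun e he i => by rw [i.2]; exact (hS e he).1) (fun e he i x => (hS e he).2.1 i x)
      (fun e he _ => (hS e he).1) (fun e he _ => (hS e he).2.2)
    have hset : #{ω | PatternOccurs a b Bd ⟨j, f, c⟩ ω ∧ ∀ e' ∈ S, ¬ PatternOccurs a b Bd e' ω} ≤
        #{ω : Equiv.Perm V × Equiv.Perm W | ((∀ i : {x // a x = b j}, ω.1 i = f i) ∧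
          ∀ _ : Unit, ω.2 j = c) ∧ ∀ e ∈ S, ¬ PatternOccurs a b Bd e ω} :=
      card_le_card (monotone_filter_right _ fun ω _ hω => ⟨⟨hω.1.2.1, fun _ => hω.1.2.2⟩, hω.2⟩)
    refine (Nat.cast_le.2 hset).trans ?_
    have hwe : w ⟨j, f, c⟩ = 2 / ((Fintype.card V : ℝ) ^ Fintype.card {x // a x = b j} *
        Fintype.card W) := if_pos hB
    have hV' : (0 : ℝ) < Fintype.card V := by exact_mod_cast hV
    have hW' : (0 : ℝ) < Fintype.card W := by exact_mod_cast hW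
    rw [hwe, div_mul_eq_mul_div, le_div_iff₀ (by positivity)]
    simp only [Fintype.card_unit, Nat.descFactorial_one] at h
    have hd : (Fintype.card V : ℝ) ^ Fintype.card {x // a x = b j} ≤
      2 * (Fintype.card V).descFactorial (Fintype.card {x // a x = b j}) := by
      exact_mod_cast hdesc (b j)
    refine le_trans (mul_le_mul_of_nonneg_left (mul_le_mul_of_nonneg_right hd hW'.le)
      (Nat.cast_nonneg _)) ?_
    calc _ = 2 * ((#{ω : Equiv.Perm V × Equiv.Perm W |
            ((∀ i : {x // a x = b j}, ω.1 i = f i) ∧ ∀ _ : Unit, ω.2 j = c) ∧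
              ∀ e ∈ S, ¬ PatternOccurs a b Bd e ω} : ℝ) *
          ((Fintype.card V).descFactorial (Fintype.card {x // a x = b j}) *
            Fintype.card W)) := by ring
      _ ≤ _ := by
        refine (le_of_eq ?_).trans (mul_le_mul_of_nonneg_left h zero_le_two)
        congr!
  obtain ⟨T, hT⟩ : ∃ T : (BlockPattern a b → Prop) → ℝ,
      ∀ P [DecidablePred P], ∑ e with P e, w e = T P :=
    ⟨fun P => ∑ e with P e, w e, fun P _ => by congr!⟩
  have hTor : ∀ P Q, T (fun e => P e ∨ Q e) ≤ T P + T Q := fun P Q => by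
    simpa only [hT] using sum_filter_or_le univ w hw0 P Q
  simp only [← hw, hT] at hT1 hT2 hT3
  have hTex : ∀ {κ : Type} [Fintype κ] (P : κ → BlockPattern a b → Prop),
      (∀ k, T (P k) ≤ 2 * K * ε) → T (fun e => ∃ k, P k e) ≤ Fintype.card κ * (2 * K * ε) := by
    intro κ _ P h
    have h' := sum_filter_exists_le univ w hw0 P
    simp only [hT] at h'
    refine h'.trans ((sum_le_card_nsmul _ _ _ fun k _ => h k).trans_eq ?_)
    rw [card_univ, nsmul_eq_mul]
  have hsum : ∀ e, T (nb e) ≤ 1 / 4 := by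
    intro e
    have h1 := hTor (fun e' => b e'.1 = b e.1)
      (fun e' => (∃ x, ∃ x', e'.2.1 x' = e.2.1 x) ∨ e'.2.2 = e.2.2)
    have h2 := hTor (fun e' => ∃ x, ∃ x', e'.2.1 x' = e.2.1 x) (fun e' => e'.2.2 = e.2.2)
    have h3 := sum_filter_exists_le univ w hw0
      (fun (x : {x // a x = b e.1}) e' => ∃ x', e'.2.1 x' = e.2.1 x)
    simp only [hT] at h3
    have h4 := h3.trans (sum_le_card_nsmul _ _ _ fun x _ => hT2 (e.2.1 x))
    rw [card_univ, nsmul_eq_mul] at h4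
    have h5 : (Fintype.card {x // a x = b e.1} : ℝ) ≤ K := by exact_mod_cast hKV (b e.1)
    have h6 := mul_le_mul_of_nonneg_right h5 hKε
    have h7 := hT1 (b e.1)
    have h8 := hT3 e.2.2
    refine h1.trans ?_
    linarith
  have hlll := lopsided_local_lemma (PatternOccurs a b Bd) w nb hw0
    (fun e S h => by convert hind e S h) (fun e => by
      refine (le_of_eq ?_).trans (hsum e)
      rw [← hT]
      congr!)
  have hw4 : ∀ e, w e ≤ 1 / 4 := fun e => by
    refine le_trans ?_ (hsum e)
    rw [← hT]
    exact single_le_sum (f := w) (fun e _ => hw0 e) (by simp [nb])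
  have hlow := avoid_lower_bound (PatternOccurs a b Bd) w hw0 hw4
    (fun S e => by convert hlll S e)
  refine ⟨({ω | ∀ e ∈ (univ : Finset (BlockPattern a b)), ¬ PatternOccurs a b Bd e ω} :
    Finset (Equiv.Perm V × Equiv.Perm W)), ?_, ?_, ?_⟩
  · rw [← card_pos]
    have h := hlow ∅ univ
    simp only [notMem_empty, false_imp_iff, implies_true, filter_true, empty_union] at h
    have h1 : (0 : ℝ) < #(univ : Finset (Equiv.Perm V × Equiv.Perm W)) := by
      exact_mod_cast card_pos.2 univ_nonempty
    exact_mod_cast (mul_pos (Real.exp_pos _) h1).trans_le h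
  · intro ω hω j hB
    exact (mem_filter.1 hω).2 ⟨j, fun x => ω.1 x, ω.2 j⟩ (mem_univ _) ⟨hB, fun _ => rfl, rfl⟩
  · intro r l p y q z hy hz
    set Z : Finset (BlockPattern a b) := {e | (∃ i, b e.1 = a (p i)) ∨
      (∃ i, ∃ x, e.2.1 x = y i) ∨ (∃ j, b e.1 = b (q j)) ∨ ∃ j, e.2.2 = z j} with hZ
    have hZsum : 4 * ∑ e ∈ Z, w e ≤ r + l := by
      have h1 := hTor (fun e => ∃ i, b e.1 = a (p i)) (fun e =>
        (∃ i, ∃ x, e.2.1 x = y i) ∨ (∃ j, b e.1 = b (q j)) ∨ ∃ j, e.2.2 = z j)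
      have h2 := hTor (fun e => ∃ i, ∃ x, e.2.1 x = y i)
        (fun e => (∃ j, b e.1 = b (q j)) ∨ ∃ j, e.2.2 = z j)
      have h3 := hTor (fun e => ∃ j, b e.1 = b (q j)) (fun e => ∃ j, e.2.2 = z j)
      have k1 := hTex (fun i e => b e.1 = a (p i)) fun i => hT1 (a (p i))
      have k2 := hTex (fun i (e : BlockPattern a b) => ∃ x, e.2.1 x = y i) fun i => hT2 (y i)
      have k3 := hTex (fun i e => b e.1 = b (q i)) fun i => hT1 (b (q i))
      have k4 := hTex (fun i (e : BlockPattern a b) => e.2.2 = z i) fun i => hT3 (z i)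
      rw [Fintype.card_fin] at k1 k2 k3 k4
      have hr : (r : ℝ) * (2 * K * ε) ≤ r * (1 / 16) := by gcongr
      have hl : (l : ℝ) * (2 * K * ε) ≤ l * (1 / 16) := by gcongr
      have hr0 : (0 : ℝ) ≤ r := by positivity
      have hl0 : (0 : ℝ) ≤ l := by positivity
      rw [hZ, hT]
      linarith
    have h1 := card_avoiding_fixing_le a b Bd p y q z hy hz (univ \ Z)
      (fun e he i h => by simp only [hZ, mem_sdiff, mem_filter, mem_univ, true_and, not_or, not_exists] at he; exact he.1 i h)
      (fun e he i x h => by simp only [hZ, mem_sdiff, mem_filter, mem_univ, true_and, not_or, not_exists] at he; exact he.2.1 i x h)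
      (fun e he i h => by simp only [hZ, mem_sdiff, mem_filter, mem_univ, true_and, not_or, not_exists] at he; exact he.2.2.1 i h)
      (fun e he i h => by simp only [hZ, mem_sdiff, mem_filter, mem_univ, true_and, not_or, not_exists] at he; exact he.2.2.2 i h)
    rw [Fintype.card_fin, Fintype.card_fin] at h1
    have h2 : Real.exp (-(4 * ∑ j ∈ Z, w j)) *
        (#{ω | ∀ e ∈ univ \ Z, ¬ PatternOccurs a b Bd e ω} : ℝ) ≤
        #{ω | ∀ e ∈ (univ : Finset (BlockPattern a b)), ¬ PatternOccurs a b Bd e ω} := by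
      refine (le_of_eq ?_).trans ((hlow (univ \ Z) Z).trans (Nat.cast_le.2 (card_le_card
        (monotone_filter_right _ fun ω _ hω e _ => hω e ?_))))
      · congr!
      · by_cases h : e ∈ Z <;> simp [h]
    have hset : #{ω ∈ ({ω | ∀ e ∈ (univ : Finset (BlockPattern a b)), ¬ PatternOccurs a b Bd e ω} :
          Finset (Equiv.Perm V × Equiv.Perm W)) |
          (∀ i, ω.1 (p i) = y i) ∧ ∀ j, ω.2 (q j) = z j} ≤
        #{ω : Equiv.Perm V × Equiv.Perm W | ((∀ i, ω.1 (p i) = y i) ∧ ∀ j, ω.2 (q j) = z j) ∧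
        ∀ e ∈ univ \ Z, ¬ PatternOccurs a b Bd e ω} := by
      rw [filter_filter]
      refine card_le_card fun ω hω => ?_
      simp only [mem_filter, mem_univ, true_and] at hω ⊢
      exact ⟨hω.2, fun e _ => hω.1 e trivial⟩
    refine (mul_le_mul_of_nonneg_right (Nat.cast_le.2 hset) (by positivity)).trans
      (((le_of_eq ?_).trans h1).trans ?_)
    · congr!
    calc _ = Real.exp (4 * ∑ j ∈ Z, w j) * (Real.exp (-(4 * ∑ j ∈ Z, w j)) *
          (#{ω | ∀ e ∈ univ \ Z, ¬ PatternOccurs a b Bd e ω} : ℝ)) := by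
          rw [← mul_assoc, ← Real.exp_add, add_neg_cancel, Real.exp_zero, one_mul]
          congr!
      _ ≤ _ := by
          refine mul_le_mul (Real.exp_le_exp.2 hZsum) h2 (by positivity) (by positivity)

end BadBlocks

theorem pow_le_exp_mul_descFactorial (N r : ℕ) (h : r ≤ N) :
    (N : ℝ) ^ r ≤ Real.exp r * N.descFactorial r := by
  induction N generalizing r with
  | zero =>
    obtain rfl : r = 0 := by omega
    simp
  | succ N ih =>
    rcases r with _ | r
    · simp
    have hr : r ≤ N := by omega
    have h1 : ((N : ℝ) + 1) ^ r ≤ Real.exp 1 * (N : ℝ) ^ r := by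
      rcases Nat.eq_zero_or_pos N with rfl | hN
      · obtain rfl : r = 0 := by omega
        simp
      · have hN' : (0 : ℝ) < N := by exact_mod_cast hN
        have h2 : ((N : ℝ) + 1) = (1 / N + 1) * N := by field_simp; ring
        rw [h2, mul_pow]
        gcongr
        calc (1 / (N : ℝ) + 1) ^ r ≤ Real.exp (1 / N) ^ r := by
              gcongr
              exact Real.add_one_le_exp _
          _ = Real.exp (r * (1 / N)) := by rw [Real.exp_nat_mul]
          _ ≤ _ := by
              gcongr
              rw [mul_one_div, div_le_one hN']
              exact_mod_cast hr
    rw [Nat.succ_descFactorial_succ]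
    push_cast
    calc ((N : ℝ) + 1) ^ (r + 1) = (N + 1) * (N + 1) ^ r := by ring
      _ ≤ (N + 1) * (Real.exp 1 * (Real.exp r * N.descFactorial r)) := by
          gcongr
          exact h1.trans (by gcongr; exact ih r hr)
      _ = _ := by rw [Real.exp_add]; ring

open Finset in
open Classical in
theorem exists_fun_card_fiber_eq {V : Type*} [Fintype V] {m : ℕ} (sz : Fin m → ℕ)
    (h : ∑ i, sz i = Fintype.card V) :
    ∃ a : V → Fin m, ∀ i, Fintype.card {x // a x = i} = sz i := by
  have e : V ≃ Σ i, Fin (sz i) := Fintype.equivOfCardEq (by simp [h])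
  refine ⟨fun x => (e x).1, fun i => ?_⟩
  rw [Fintype.card_congr ((e.subtypeEquiv (q := fun y => y.1 = i) fun x => Iff.rfl).trans
    (Equiv.sigmaSubtype i)), Fintype.card_fin]

section Clusters

variable {V W I : Type*} [Fintype V] [Fintype W]

open Finset in
open Classical in
/-- The partition obtained by moving the fibers of `a` by a permutation. -/
noncomputable def permutedFibers (a : V → I) (σ : Equiv.Perm V) (i : I) : Finset V :=
  ({x | a x = i} : Finset V).image σ

open Finset in
theorem mem_permutedFibers {a : V → I} {σ : Equiv.Perm V} {i : I} {y : V} :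
    y ∈ permutedFibers a σ i ↔ a (σ.symm y) = i := by
  simp only [permutedFibers, mem_image, mem_filter, mem_univ, true_and]
  refine ⟨?_, fun h => ⟨_, h, by simp⟩⟩
  rintro ⟨x, hx, rfl⟩
  simpa using hx

open Classical in
theorem card_permutedFibers (a : V → I) (σ : Equiv.Perm V) (i : I) :
    (permutedFibers a σ i).card = Fintype.card {x // a x = i} := by
  rw [permutedFibers, Finset.card_image_of_injective _ σ.injective, Fintype.card_subtype]

theorem disjoint_permutedFibers (a : V → I) (σ : Equiv.Perm V) {i j : I} (h : i ≠ j) :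
    Disjoint (permutedFibers a σ i) (permutedFibers a σ j) := by
  rw [Finset.disjoint_left]
  intro x hi hj
  rw [mem_permutedFibers] at hi hj
  exact h (hi.symm.trans hj)

open Classical in
theorem biUnion_permutedFibers [Fintype I] (a : V → I) (σ : Equiv.Perm V) :
    Finset.univ.biUnion (permutedFibers a σ) = Finset.univ := by
  ext x
  simp [mem_permutedFibers]

open Finset in
open Classical in
theorem exists_spread_distribution [Fintype I] (a : V → I) (b : W → I) (K n : ℕ) (hn : 0 < n)
    (hV : n ≤ Fintype.card V) (hW : n ≤ Fintype.card W)
    (hKV : ∀ i, Fintype.card {x // a x = i} ≤ K) (hKW : ∀ i, Fintype.card {y // b y = i} ≤ K)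
    (G : Finset (Equiv.Perm V × Equiv.Perm W)) (hG : G.Nonempty)
    (hspread : ∀ (r l : ℕ) (p y : Fin r → V) (q z : Fin l → W), Function.Injective y →
        Function.Injective z →
        (#{ω ∈ G | (∀ i, ω.1 (p i) = y i) ∧ ∀ j, ω.2 (q j) = z j} : ℝ) *
          ((Fintype.card V).descFactorial r * (Fintype.card W).descFactorial l) ≤
          Real.exp (r + l) * #G) :
    ∃ μ : ((I → Finset V) × (I → Finset W)) → ℝ, (∀ x, 0 ≤ μ x) ∧ ∑ x, μ x = 1 ∧
      (∀ x, μ x ≠ 0 → ∃ ω ∈ G, x = (permutedFibers a ω.1, permutedFibers b ω.2)) ∧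
      ∀ (r l : ℕ) (y : Fin r → V) (c : Fin l → W), Function.Injective y →
        Function.Injective c → ∀ (f : Fin r → I) (g : Fin l → I),
        ∑ x with (∀ i, y i ∈ x.1 (f i)) ∧ (∀ j, c j ∈ x.2 (g j)), μ x ≤
          (K * Real.exp 2 / n) ^ (r + l) := by
  set F : Equiv.Perm V × Equiv.Perm W → (I → Finset V) × (I → Finset W) := fun ω =>
    (permutedFibers a ω.1, permutedFibers b ω.2) with hF
  have hG0 : (0 : ℝ) < #G := by exact_mod_cast card_pos.2 hG
  refine ⟨fun x => #{ω ∈ G | F ω = x} / #G, fun x => by positivity, ?_, ?_, ?_⟩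
  · rw [← sum_div, div_eq_one_iff_eq hG0.ne', ← Nat.cast_sum,
      ← card_eq_sum_card_fiberwise (fun _ _ => mem_coe.2 (mem_univ _))]
  · intro x hx
    have : #{ω ∈ G | F ω = x} ≠ 0 := fun h => hx (by simp [h])
    obtain ⟨ω, hω⟩ := card_ne_zero.1 this
    rw [mem_filter] at hω
    exact ⟨ω, hω.1, hω.2.symm⟩
  · intro r l y c hy hc f g
    have hsum : ∑ x with (∀ i, y i ∈ x.1 (f i)) ∧ (∀ j, c j ∈ x.2 (g j)),
        ((#{ω ∈ G | F ω = x} : ℝ) / #G) =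
        (#{ω ∈ G | (∀ i, y i ∈ (F ω).1 (f i)) ∧ (∀ j, c j ∈ (F ω).2 (g j))} : ℝ) / #G := by
      rw [← sum_div, ← Nat.cast_sum]
      congr 2
      rw [card_eq_sum_card_fiberwise (f := F) (t := {x | (∀ i, y i ∈ x.1 (f i)) ∧
        (∀ j, c j ∈ x.2 (g j))}) (fun ω hω => by simpa using (mem_filter.1 hω).2)]
      refine sum_congr rfl fun x hx => ?_
      rw [filter_filter]
      congr 1
      refine filter_congr fun ω _ => ?_
      simp only [mem_filter, mem_univ, true_and] at hx
      constructor
      · rintro rfl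
        exact ⟨hx, rfl⟩
      · exact fun h => h.2
    rw [hsum, div_le_iff₀ hG0]
    have hcover : ({ω ∈ G | (∀ i, y i ∈ (F ω).1 (f i)) ∧ (∀ j, c j ∈ (F ω).2 (g j))} :
        Finset (Equiv.Perm V × Equiv.Perm W)) ⊆
        (univ : Finset ((∀ i, {x // a x = f i}) × (∀ j, {x // b x = g j}))).biUnion
          fun pq => {ω ∈ G | (∀ i, ω.1 (pq.1 i) = y i) ∧ ∀ j, ω.2 (pq.2 j) = c j} := by
      intro ω hω
      simp only [mem_filter, hF, mem_permutedFibers, mem_biUnion, mem_univ, true_and] at hω ⊢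
      exact ⟨(fun i => ⟨ω.1.symm (y i), hω.2.1 i⟩, fun j => ⟨ω.2.symm (c j), hω.2.2 j⟩), hω.1,
        fun i => by simp, fun j => by simp⟩
    have hV0 : (0 : ℝ) < Fintype.card V := by exact_mod_cast hn.trans_le hV
    have hW0 : (0 : ℝ) < Fintype.card W := by exact_mod_cast hn.trans_le hW
    have hr : r ≤ Fintype.card V := by simpa using Fintype.card_le_of_injective y hy
    have hl : l ≤ Fintype.card W := by simpa using Fintype.card_le_of_injective c hc
    have hone : ∀ pq : (∀ i, {x // a x = f i}) × (∀ j, {x // b x = g j}),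
        (#{ω ∈ G | (∀ i, ω.1 (pq.1 i) = y i) ∧ ∀ j, ω.2 (pq.2 j) = c j} : ℝ) ≤
          (Real.exp 2 / n) ^ (r + l) * #G := by
      intro pq
      have h := hspread r l (fun i => pq.1 i) y (fun j => pq.2 j) c hy hc
      set X : ℝ := (#{ω ∈ G | (∀ i, ω.1 (pq.1 i) = y i) ∧ ∀ j, ω.2 (pq.2 j) = c j} : ℝ) with hX
      have hX0 : 0 ≤ X := by positivity
      have hn0 : (0 : ℝ) < n := by exact_mod_cast hn
      have e1 : (n : ℝ) ^ r ≤ Real.exp r * (Fintype.card V).descFactorial r :=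
        (pow_le_pow_left₀ hn0.le (by exact_mod_cast hV) r).trans
          (pow_le_exp_mul_descFactorial _ r hr)
      have e2 : (n : ℝ) ^ l ≤ Real.exp l * (Fintype.card W).descFactorial l :=
        (pow_le_pow_left₀ hn0.le (by exact_mod_cast hW) l).trans
          (pow_le_exp_mul_descFactorial _ l hl)
      rw [div_pow, div_mul_eq_mul_div, le_div_iff₀ (by positivity), pow_add]
      calc X * ((n : ℝ) ^ r * (n : ℝ) ^ l) ≤ X * ((Real.exp r *
            (Fintype.card V).descFactorial r) * (Real.exp l *
            (Fintype.card W).descFactorial l)) := by gcongr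
        _ = Real.exp (r + l) * (X * ((Fintype.card V).descFactorial r *
            (Fintype.card W).descFactorial l)) := by rw [Real.exp_add]; ring
        _ ≤ Real.exp (r + l) * (Real.exp (r + l) * #G) := by gcongr
        _ = _ := by
          rw [← Real.exp_nat_mul, ← mul_assoc, ← Real.exp_add]
          congr 2
          push_cast
          ring
    have hcount : (Fintype.card ((∀ i, {x // a x = f i}) × (∀ j, {x // b x = g j})) : ℝ) ≤
        (K : ℝ) ^ (r + l) := by
      have h1 : Fintype.card ((∀ i, {x // a x = f i}) × (∀ j, {x // b x = g j})) ≤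
          K ^ (r + l) := by
        rw [Fintype.card_prod, Fintype.card_pi, Fintype.card_pi, pow_add]
        refine Nat.mul_le_mul ((prod_le_pow_card _ _ K fun i _ => hKV (f i)).trans_eq (by simp))
          ((prod_le_pow_card _ _ K fun i _ => hKW (g i)).trans_eq (by simp))
      exact_mod_cast h1
    calc (#{ω ∈ G | (∀ i, y i ∈ (F ω).1 (f i)) ∧ (∀ j, c j ∈ (F ω).2 (g j))} : ℝ) ≤
          ∑ pq : (∀ i, {x // a x = f i}) × (∀ j, {x // b x = g j}),
          (#{ω ∈ G | (∀ i, ω.1 (pq.1 i) = y i) ∧ ∀ j, ω.2 (pq.2 j) = c j} : ℝ) := by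
          exact_mod_cast (card_le_card hcover).trans card_biUnion_le
      _ ≤ Fintype.card ((∀ i, {x // a x = f i}) × (∀ j, {x // b x = g j})) *
          ((Real.exp 2 / n) ^ (r + l) * #G) := by
          refine (sum_le_card_nsmul _ _ _ fun pq _ => hone pq).trans_eq ?_
          rw [card_univ, nsmul_eq_mul]
      _ ≤ (K : ℝ) ^ (r + l) * ((Real.exp 2 / n) ^ (r + l) * #G) := by gcongr
      _ = _ := by rw [mul_div_assoc, mul_pow]; ring

end Clusters

theorem one_sub_mul_pow_le_descFactorial {N d u k : ℕ} {τ : ℝ} (hdu : d + u ≤ k) (hk : k ≤ N)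
    (hN : 0 < N) (hτ : (k : ℝ) ^ 2 ≤ τ * N) :
    (1 - τ) * (N : ℝ) ^ u ≤ (N - d).descFactorial u := by
  have hN' : (0 : ℝ) < N := by exact_mod_cast hN
  have h1 : (N - k) ^ u ≤ (N - d).descFactorial u :=
    (Nat.pow_le_pow_left (by omega) u).trans (Nat.pow_sub_le_descFactorial (N - d) u)
  have h2 : ((N : ℝ) - k) ^ u ≤ (N - d).descFactorial u := by
    rw [← Nat.cast_sub hk]
    exact_mod_cast h1
  refine le_trans ?_ h2
  have hkN : (k : ℝ) / N ≤ 1 := by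
    rw [div_le_one hN']
    exact_mod_cast hk
  have h3 := one_add_mul_le_pow (a := -((k : ℝ) / N)) (by linarith) u
  have h4 : (u : ℝ) * (k / N) ≤ τ := by
    rw [← mul_div_assoc, div_le_iff₀ hN']
    refine le_trans ?_ hτ
    rw [sq]
    gcongr
    omega
  have h5 : (N : ℝ) - k = (1 + -((k : ℝ) / N)) * N := by field_simp; ring
  rw [h5, mul_pow]
  gcongr
  linarith

open Finset in
open Classical in
theorem card_deficient_block_le_pow_mul_exp {V B : Type*} [Fintype V] [Fintype B]
    [DecidableEq V] [DecidableEq B] (H : Finset (Finset V)) {k d C K : ℕ} {α δ τ : ℝ}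
    (hα : 0 < α) (hδ : 0 ≤ δ) (hδ1 : δ ≤ 1) (hd : d < k) (hH : ∀ e ∈ H, #e = k)
    (hdeg : ∀ D : Finset V, #D = d →
      (δ + α) * ((Fintype.card V - d).choose (k - d) : ℝ) ≤ #{e ∈ H | D ⊆ e})
    (hτ : τ = α / (8 * (1 + α))) (hkC : 2 * k ≤ C) (hCB : C ≤ Fintype.card B)
    (hBK : Fintype.card B ≤ K) (hKV : K ≤ Fintype.card V) (hC : ((2 * k : ℕ) : ℝ) ^ 2 ≤ τ * C)
    (p : B) (v : V) :
    (#{f : B → V | (∃ D, #D = d ∧ IsDeficientOn H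
      ((δ + α / 2) * ((Fintype.card B - d).choose (k - d))) D f) ∧ f p = v} : ℝ) *
        Fintype.card V ≤
      (K : ℝ) ^ k * Real.exp (-(α ^ 2 / (512 * k) * C)) *
        (Fintype.card V : ℝ) ^ Fintype.card B := by
  obtain ⟨u, rfl⟩ : ∃ u, k = d + u := ⟨k - d, by omega⟩
  have hu : 0 < u := by omega
  rw [Nat.add_sub_cancel_left] at *
  have hτ0 : 0 < τ := by rw [hτ]; positivity
  have hτα : (1 + α) * τ = α / 8 := by rw [hτ]; field_simp
  have hτ1 : τ ≤ 1 := by nlinarith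
  set N := Fintype.card V with hN
  set L := Fintype.card B with hL
  have hL0 : 0 < L := by omega
  have hN0 : 0 < N := by omega
  have hCL : τ * C ≤ τ * L := by gcongr
  have hLN : τ * L ≤ τ * N := by gcongr; omega
  set b := (L - d - 1) / u with hb
  have hbu : b * u ≤ L - d - 1 := Nat.div_mul_le_self _ _
  have hbu' : L - (d + u) ≤ b * u := by
    have := Nat.lt_div_mul_add (a := L - d - 1) hu
    rw [← hb] at this
    omega
  have hfac : (0 : ℝ) < u.factorial := by exact_mod_cast u.factorial_pos
  have hδτ : (δ + α) * τ ≤ α / 8 := by rw [← hτα]; gcongr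
  refine (card_deficient_block_le H d u b (δ + α / 2) ((δ + α) * (1 - τ)) (α / 8)
    (Real.exp (-(b * (α / 8) ^ 2 / 4))) (by positivity) hH ?_ (by omega) ?_ le_rfl p v).trans ?_
  · intro D hD
    have h1 := one_sub_mul_pow_le_descFactorial (N := N) (d := d) (u := u) (k := d + u) (τ := τ)
      le_rfl (by omega) hN0 (le_trans (by gcongr; omega) (hC.trans (hCL.trans hLN)))
    rw [Nat.descFactorial_eq_factorial_mul_choose, Nat.cast_mul] at h1
    calc (δ + α) * (1 - τ) * (N : ℝ) ^ u = (δ + α) * ((1 - τ) * (N : ℝ) ^ u) := by ring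
      _ ≤ (δ + α) * (u.factorial * (N - d).choose u) := by gcongr
      _ = u.factorial * ((δ + α) * (N - d).choose u) := by ring
      _ ≤ _ := by
        gcongr
        exact hdeg D hD
  · have h1 := one_sub_mul_pow_le_descFactorial (N := L) (d := d + u) (u := u)
      (k := 2 * (d + u)) (τ := τ) (by omega) (by omega) hL0 (hC.trans hCL)
    have h2 : ((L - (d + u)).descFactorial u : ℝ) ≤ (b * u).descFactorial u := by
      exact_mod_cast Nat.descFactorial_le u hbu'
    have h3 : ((L - d).descFactorial u : ℝ) ≤ (L : ℝ) ^ u := by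
      exact_mod_cast (Nat.descFactorial_le_pow _ _).trans (Nat.pow_le_pow_left (by omega) u)
    have h4 : δ + α / 2 ≤ ((δ + α) * (1 - τ) - α / 8) * (1 - τ) := by nlinarith
    have h5 : 0 ≤ (δ + α) * (1 - τ) - α / 8 := by nlinarith
    refine le_of_mul_le_mul_left ?_ hfac
    calc (u.factorial : ℝ) * ((δ + α / 2) * (L - d).choose u) =
          (δ + α / 2) * (L - d).descFactorial u := by
          rw [Nat.descFactorial_eq_factorial_mul_choose]
          push_cast
          ring
      _ ≤ (((δ + α) * (1 - τ) - α / 8) * (1 - τ)) * (L : ℝ) ^ u := by gcongr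
      _ = ((δ + α) * (1 - τ) - α / 8) * ((1 - τ) * (L : ℝ) ^ u) := by ring
      _ ≤ ((δ + α) * (1 - τ) - α / 8) * (b * u).descFactorial u :=
          mul_le_mul_of_nonneg_left (h1.trans h2) h5
      _ = _ := by
          rw [Nat.descFactorial_eq_factorial_mul_choose]
          push_cast
          ring
  · have hk0 : (0 : ℝ) < (d + u : ℕ) := by exact_mod_cast (by omega : 0 < d + u)
    have h1 : (L : ℝ) ^ d ≤ (K : ℝ) ^ (d + u) := by
      have : L ^ d ≤ K ^ (d + u) :=
        (Nat.pow_le_pow_left hBK d).trans (Nat.pow_le_pow_right (by omega) (by omega))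
      exact_mod_cast this
    have h2 : (C : ℝ) / (2 * (d + u : ℕ)) ≤ b := by
      rw [div_le_iff₀ (by positivity)]
      have h3 : C ≤ b * (2 * (d + u)) := by
        have : b * (2 * (d + u)) = 2 * (b * u) + 2 * (b * d) := by ring
        omega
      exact_mod_cast h3
    gcongr
    calc α ^ 2 / (512 * (d + u : ℕ)) * C = (C / (2 * (d + u : ℕ))) * (α / 8) ^ 2 / 4 := by
          field_simp
          ring
      _ ≤ _ := by gcongr

open Filter in
theorem eventually_mul_pow_mul_exp_le (a κ c : ℝ) (hκ : 0 < κ) (hc : 0 < c) (p : ℕ) :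
    ∀ᶠ C : ℕ in atTop, a * (C : ℝ) ^ p * Real.exp (-(κ * C)) ≤ c := by
  have h1 : Tendsto (fun C : ℕ => κ * (C : ℝ)) atTop atTop :=
    tendsto_natCast_atTop_atTop.const_mul_atTop hκ
  have h2 := ((Real.tendsto_pow_mul_exp_neg_atTop_nhds_zero p).comp h1).const_mul (a / κ ^ p)
  rw [mul_zero] at h2
  filter_upwards [h2.eventually (ge_mem_nhds hc)] with C hC
  refine (le_of_eq ?_).trans hC
  simp only [Function.comp_apply, mul_pow]
  field_simp

theorem exists_block_sizes {C n : ℕ} (hC : 2 ≤ C) (hn : C * (C - 1) ≤ n) :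
    ∃ m : ℕ, 0 < m ∧ ∀ s : ℕ, ∑ i : Fin m, (if i.val = 0 then
      s * C * (C - 1) + (s * n) % (s * C * (C - 1)) else s * C) = s * n := by
  set q := C * (C - 1) with hq
  have hq0 : 0 < q := Nat.mul_pos (by omega) (by omega)
  have h1 : 1 ≤ n / q := (Nat.one_le_div_iff hq0).2 hn
  refine ⟨(C - 1) * (n / q - 1) + 1, by omega, fun s => ?_⟩
  rw [Fin.sum_univ_succ]
  simp only [Fin.val_zero, if_true, Fin.val_succ, Nat.add_eq_zero_iff, one_ne_zero, and_false,
    if_false, Finset.sum_const, Finset.card_univ, Fintype.card_fin, smul_eq_mul]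
  rw [mul_assoc s C, ← hq, Nat.mul_mod_mul_left]
  obtain ⟨x, hx⟩ : ∃ x, n / q = x + 1 := ⟨n / q - 1, by omega⟩
  have h2 := Nat.div_add_mod n q
  rw [hx] at h2 ⊢
  conv_rhs => rw [← h2]
  rw [Nat.add_sub_cancel]
  have h3 : (C - 1) * x * (s * C) = s * (q * x) := by rw [hq]; ring
  rw [h3]
  ring

theorem block_size_mem_Icc {C s n i : ℕ} (hC : 2 ≤ C) (hs : 0 < s) :
    C ≤ (if i = 0 then s * C * (C - 1) + (s * n) % (s * C * (C - 1)) else s * C) ∧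
      (if i = 0 then s * C * (C - 1) + (s * n) % (s * C * (C - 1)) else s * C) ≤
        2 * s * C ^ 2 := by
  obtain ⟨c, rfl⟩ : ∃ c, C = c + 1 := ⟨C - 1, by omega⟩
  rw [Nat.add_sub_cancel]
  have h0 : c + 1 ≤ s * (c + 1) := Nat.le_mul_of_pos_left _ hs
  have h1 : s * (c + 1) ≤ s * (c + 1) * c := Nat.le_mul_of_pos_right _ (by omega)
  have h2 := Nat.mod_lt (s * n) (show 0 < s * (c + 1) * c by omega)
  split_ifs
  · constructor
    · omega
    · nlinarith
  · constructor
    · omega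
    · nlinarith

open Finset in
open Classical in
theorem le_card_of_not_isDeficientOn {V I : Type*} [Fintype V] [DecidableEq V]
    (H : Finset (Finset V))
    (a : V → I) (σ : Equiv.Perm V) (i : I) (d : ℕ) (x : ℝ)
    (h : ¬ ∃ D, #D = d ∧ IsDeficientOn H x D (fun x : {x // a x = i} => σ x))
    (D : Finset V) (hD : D ⊆ permutedFibers a σ i) (hDd : #D = d) :
    x ≤ #{e ∈ H | D ⊆ e ∧ e ⊆ permutedFibers a σ i} := by
  have hinj : Function.Injective (fun x : {x // a x = i} => σ x) :=
    σ.injective.comp Subtype.val_injective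
  have himg : (univ : Finset {x // a x = i}).image (fun x : {x // a x = i} => σ x) = permutedFibers a σ i := by
    ext y
    simp only [mem_image, mem_univ, true_and, mem_permutedFibers, Subtype.exists]
    refine ⟨?_, fun h => ⟨σ.symm y, h, by simp⟩⟩
    rintro ⟨x, hx, rfl⟩
    simpa using hx
  rw [← himg] at hD
  obtain ⟨D', -, rfl⟩ := subset_image_iff.1 hD
  by_contra hlt
  refine h ⟨D', ?_, hinj, ?_⟩
  · rw [← hDd, card_image_of_injective _ hinj]
  · rw [not_le] at hlt
    rw [← himg] at hlt
    refine (le_of_eq ?_).trans_lt hlt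
    congr!

open Finset in
open Classical in
theorem exists_spread_clustering {V W I : Type*} [Fintype V] [Fintype W] [Fintype I]
    (a : V → I) (b : W → I) (Hs : W → Finset (Finset V)) {k d C K n : ℕ} {α δ τ : ℝ}
    (hα : 0 < α) (hδ : 0 ≤ δ) (hδ1 : δ ≤ 1) (hd : d < k) (hH : ∀ c, ∀ e ∈ Hs c, #e = k)
    (hdeg : ∀ c (D : Finset V), #D = d →
      (δ + α) * ((Fintype.card V - d).choose (k - d) : ℝ) ≤ #{e ∈ Hs c | D ⊆ e})
    (hτ : τ = α / (8 * (1 + α))) (hkC : 2 * k ≤ C) (hC : ((2 * k : ℕ) : ℝ) ^ 2 ≤ τ * C)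
    (hCa : ∀ i, C ≤ Fintype.card {x // a x = i}) (hKa : ∀ i, Fintype.card {x // a x = i} ≤ K)
    (hKb : ∀ i, Fintype.card {x // b x = i} ≤ K) (hCK : C ≤ K) (hn : 2 * K ^ 2 ≤ n)
    (hnV : n ≤ Fintype.card V) (hnW : n ≤ Fintype.card W)
    (hsmall : 2 * K * ((K : ℝ) ^ k * Real.exp (-(α ^ 2 / (512 * k) * C))) * (K + 2) ≤ 1 / 8) :
    ∃ μ : ((I → Finset V) × (I → Finset W)) → ℝ, (∀ x, 0 ≤ μ x) ∧ ∑ x, μ x = 1 ∧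
      (∀ x, μ x ≠ 0 → ∃ σ ψ, x = (permutedFibers a σ, permutedFibers b ψ) ∧
        ∀ i, ∀ j ∈ permutedFibers b ψ i, ∀ D ⊆ permutedFibers a σ i, #D = d →
          (δ + α / 2) * (((permutedFibers a σ i).card - d).choose (k - d) : ℝ) ≤
            #{e ∈ Hs j | D ⊆ e ∧ e ⊆ permutedFibers a σ i}) ∧
      ∀ (r l : ℕ) (y : Fin r → V) (c : Fin l → W), Function.Injective y →
        Function.Injective c → ∀ (f : Fin r → I) (g : Fin l → I),
        ∑ x with (∀ i, y i ∈ x.1 (f i)) ∧ (∀ j, c j ∈ x.2 (g j)), μ x ≤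
          (K * Real.exp 2 / n) ^ (r + l) := by
  have hK1 : 1 ≤ K := by omega
  have hKn : K ≤ n := by nlinarith
  have hn0 : 0 < n := by omega
  obtain ⟨G, hG, hgood, hspread⟩ := exists_spread_avoiding_bad_blocks a b
    (fun i f c => ∃ D, #D = d ∧ IsDeficientOn (Hs c)
      ((δ + α / 2) * ((Fintype.card {x // a x = i} - d).choose (k - d))) D f)
    ((K : ℝ) ^ k * Real.exp (-(α ^ 2 / (512 * k) * C))) K (by positivity) (by omega) (by omega)
    hK1 (fun i => Fintype.card_pos_iff.1 (by have := hCa i; omega)) hKa hKb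
    (by
      intro i
      have hN0 : 0 < Fintype.card V := by omega
      have h := one_sub_mul_pow_le_descFactorial (N := Fintype.card V) (d := 0)
        (u := Fintype.card {x // a x = i}) (k := K) (τ := 1 / 2) (by simpa using hKa i) (by omega)
        hN0 (by
          have : ((2 * K ^ 2 : ℕ) : ℝ) ≤ Fintype.card V := by exact_mod_cast hn.trans hnV
          push_cast at this
          linarith)
      rw [Nat.sub_zero] at h
      have h' : (Fintype.card V : ℝ) ^ Fintype.card {x // a x = i} ≤
          2 * (Fintype.card V).descFactorial (Fintype.card {x // a x = i}) := by linarith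
      exact_mod_cast h')
    (by
      rintro i f c ⟨D, -, hf, -⟩
      exact hf)
    (by
      intro i c p v
      have h := card_deficient_block_le_pow_mul_exp (Hs c) hα hδ hδ1 hd (hH c) (fun D hD =>
        (hdeg c D hD).trans (le_of_eq (by congr!))) hτ hkC (hCa i) (hKa i) (hKn.trans hnV) hC p v
      refine le_trans (mul_le_mul_of_nonneg_right (le_of_eq ?_) (Nat.cast_nonneg _)) h
      congr!)
    hsmall
  obtain ⟨μ, h0, h1, h2, h3⟩ := exists_spread_distribution a b K n hn0 hnV hnW hKa hKb G hG
    hspread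
  refine ⟨μ, h0, h1, fun x hx => ?_, h3⟩
  obtain ⟨ω, hω, rfl⟩ := h2 x hx
  refine ⟨ω.1, ω.2, rfl, fun i j hj D hD hDd => ?_⟩
  rw [mem_permutedFibers] at hj
  have h := hgood ω hω (ω.2.symm j)
  rw [hj, Equiv.apply_symm_apply] at h
  rw [card_permutedFibers]
  exact le_card_of_not_isDeficientOn _ a ω.1 i d _ h D hD hDd

open Classical in
theorem random_clustering_systems
    (α : ℝ) (hα : 0 < α) (k s t : ℕ) (hk : 0 < k) (hs : 0 < s) (ht : 0 < t) :
    ∃ C₀ : ℕ, ∀ C : ℕ, C₀ ≤ C →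
    ∃ C'₀ : ℝ, ∀ C' : ℝ, C'₀ ≤ C' →
    ∃ n₀ : ℕ, ∀ n : ℕ, n₀ ≤ n →
    ∀ δ : ℝ, 0 ≤ δ → δ ≤ 1 →
    ∀ d : ℕ, 1 ≤ d → d ≤ k - 1 →
    ∀ Hs : Fin (t * n) → Finset (Finset (Fin (s * n))),
      (∀ i, ∀ e ∈ Hs i, e.card = k) →
      (∀ i (D : Finset (Fin (s * n))), D.card = d →
        (δ + α) * ((s * n - d).choose (k - d) : ℝ) ≤
          (((Hs i).filter fun e => D ⊆ e).card : ℝ)) →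
    ∃ m : ℕ, 0 < m ∧
    ∃ μ : ((Fin m → Finset (Fin (s * n))) × (Fin m → Finset (Fin (t * n)))) → ℝ,
      (∀ x, 0 ≤ μ x) ∧ (∑ x, μ x = 1) ∧
      (∀ UW, μ UW ≠ 0 →
        -- `UW.1` is a partition of the vertex set, `UW.2` a partition of the color set
        ((∀ i j : Fin m, i ≠ j → Disjoint (UW.1 i) (UW.1 j)) ∧
          Finset.univ.biUnion UW.1 = Finset.univ ∧
          (∀ i j : Fin m, i ≠ j → Disjoint (UW.2 i) (UW.2 j)) ∧
          Finset.univ.biUnion UW.2 = Finset.univ) ∧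
        -- (1) sizes of the parts
        (∀ i : Fin m, i.val = 0 →
          (UW.1 i).card = s * C * (C - 1) + (s * n) % (s * C * (C - 1)) ∧
          (UW.2 i).card = t * C * (C - 1) + (t * n) % (t * C * (C - 1))) ∧
        (∀ i : Fin m, i.val ≠ 0 → (UW.1 i).card = s * C ∧ (UW.2 i).card = t * C) ∧
        -- (2) minimum degree of each sub-system `{H_j[U_i] : j ∈ W_i}`
        (∀ i : Fin m, ∀ j ∈ UW.2 i, ∀ D : Finset (Fin (s * n)), D ⊆ UW.1 i → D.card = d →
          (δ + α / 2) * ((((UW.1 i).card - d).choose (k - d)) : ℝ) ≤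
            (((Hs j).filter fun e => D ⊆ e ∧ e ⊆ UW.1 i).card : ℝ))) ∧
      -- (3) spreadness
      (∀ (r ℓ : ℕ) (y : Fin r → Fin (s * n)) (c : Fin ℓ → Fin (t * n)),
        Function.Injective y → Function.Injective c →
        ∀ (f : Fin r → Fin m) (g : Fin ℓ → Fin m),
          ∑ x ∈ Finset.univ.filter
              (fun x : (Fin m → Finset (Fin (s * n))) × (Fin m → Finset (Fin (t * n))) =>
                (∀ i, y i ∈ x.1 (f i)) ∧ (∀ j, c j ∈ x.2 (g j))), μ x ≤
            (C' / n) ^ (r + ℓ)) := by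
  have hk0 : (0 : ℝ) < k := by exact_mod_cast hk
  set τ : ℝ := α / (8 * (1 + α)) with hτ
  have hτ0 : 0 < τ := by positivity
  obtain ⟨C₁, hC₁⟩ := Filter.eventually_atTop.1 (eventually_mul_pow_mul_exp_le
    (4 * (2 * (s + t) : ℝ) ^ (k + 2)) (α ^ 2 / (512 * k)) (1 / 8) (by positivity) (by norm_num)
    (2 * (k + 2)))
  obtain ⟨C₂, hC₂⟩ := exists_nat_ge (((2 * k : ℕ) : ℝ) ^ 2 / τ)
  refine ⟨C₁ + C₂ + 2 * k + 2, fun C hC => ?_⟩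
  set K : ℕ := 2 * (s + t) * C ^ 2 with hK
  refine ⟨K * Real.exp 2, fun C' hC' => ⟨2 * K ^ 2 + C * (C - 1), fun n hn δ hδ hδ1 d hd1 hdk
    Hs hH hdeg => ?_⟩⟩
  have hC2 : 2 ≤ C := by omega
  have hKs : 2 * s * C ^ 2 ≤ K := by rw [hK]; gcongr; omega
  have hKt : 2 * t * C ^ 2 ≤ K := by rw [hK]; gcongr; omega
  have hCK : C ≤ K := by
    refine le_trans ?_ hKs
    nlinarith [Nat.mul_le_mul hs hC2]
  have hn0 : 0 < n := by nlinarith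
  obtain ⟨m, hm, hsum⟩ := exists_block_sizes hC2 (by omega : C * (C - 1) ≤ n)
  obtain ⟨a, ha⟩ := exists_fun_card_fiber_eq (V := Fin (s * n)) _ ((hsum s).trans (by simp))
  obtain ⟨b, hb⟩ := exists_fun_card_fiber_eq (V := Fin (t * n)) _ ((hsum t).trans (by simp))
  replace ha (i : Fin m) [Fintype {x // a x = i}] : Fintype.card {x // a x = i} =
      if i.val = 0 then s * C * (C - 1) + s * n % (s * C * (C - 1)) else s * C := by
    convert ha i
  replace hb (i : Fin m) [Fintype {x // b x = i}] : Fintype.card {x // b x = i} =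
      if i.val = 0 then t * C * (C - 1) + t * n % (t * C * (C - 1)) else t * C := by
    convert hb i
  obtain ⟨μ, h0, h1, h2, h3⟩ := exists_spread_clustering (C := C) (K := K) (n := n) (τ := τ)
    (k := k) (d := d) a b Hs hα hδ hδ1 (by omega) hH
    (fun c D hD => by
      rw [Fintype.card_fin]
      refine (hdeg c D hD).trans (le_of_eq ?_)
      congr!) hτ (by omega)
    (by
      rw [div_le_iff₀ hτ0, mul_comm (C₂ : ℝ) τ] at hC₂
      refine hC₂.trans ?_
      gcongr
      omega)
    (fun i => by rw [ha]; exact (block_size_mem_Icc hC2 hs).1)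
    (fun i => by rw [ha]; exact (block_size_mem_Icc hC2 hs).2.trans hKs)
    (fun i => by rw [hb]; exact (block_size_mem_Icc hC2 ht).2.trans hKt) hCK (by omega)
    (by rw [Fintype.card_fin]; exact Nat.le_mul_of_pos_left _ hs)
    (by rw [Fintype.card_fin]; exact Nat.le_mul_of_pos_left _ ht)
    (by
      refine le_trans ?_ (hC₁ C (by omega))
      have hK2 : (2 : ℝ) ≤ K := by exact_mod_cast hC2.trans hCK
      set E := Real.exp (-(α ^ 2 / (512 * k) * C)) with hE
      have hE0 : 0 < E := Real.exp_pos _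
      calc 2 * (K : ℝ) * ((K : ℝ) ^ k * E) * (K + 2) ≤ 2 * (K : ℝ) * ((K : ℝ) ^ k * E) * (K + K) := by
            gcongr
        _ = 4 * (K : ℝ) ^ (k + 2) * E := by ring
        _ = _ := by
            rw [hK, pow_mul (C : ℝ) 2 (k + 2)]
            push_cast
            rw [mul_pow]
            ring)
  refine ⟨m, hm, μ, h0, by convert h1, fun x hx => ?_, fun r l y c hy hc f g => ?_⟩
  · obtain ⟨σ, ψ, rfl, hdegree⟩ := h2 x hx
    refine ⟨⟨fun i j h => disjoint_permutedFibers a σ h, ?_,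
      fun i j h => disjoint_permutedFibers b ψ h, ?_⟩, fun i hi => ?_, fun i hi => ?_, ?_⟩
    · convert biUnion_permutedFibers a σ
    · convert biUnion_permutedFibers b ψ
    · rw [card_permutedFibers, card_permutedFibers, ha, hb, if_pos hi, if_pos hi]
      exact ⟨rfl, rfl⟩
    · rw [card_permutedFibers, card_permutedFibers, ha, hb, if_neg hi, if_neg hi]
      exact ⟨rfl, rfl⟩
    · intro i j hj D hD hDd
      refine (hdegree i j hj D hD hDd).trans (le_of_eq ?_)
      congr!
  · refine (le_of_eq ?_).trans ((h3 r l y c hy hc f g).trans ?_)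
    · congr!
    · gcongr
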